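/- Let U ∈ 𝔖_F(𝕊_1^+) with F ∈ L^∞(𝕊_1^+). Then for almost every r ∈ (0,1), the function r ↦ D(U,r) is differentiable at r and D′(U,r) = r^{−3} ∫_{𝕊_r^+} (ZU)² Ḡ_a y^a dX dt + 2 r^{−3} ∫_{𝕊_r^+} |t| (ZU) F Ḡ_a y^a dX dt. -/

import Mathlib

/- Formalization of results from "The structure of the singular set in the thin obstacle
problem for degenerate parabolic equations" by Banerjee, Danielli, Garofalo, Petrosyan.

Points of ℝ^{n+1} are written X = (x,y) with x : Fin n → ℝ and y : ℝ; functions of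
space-time are `U : (Fin n → ℝ) → ℝ → ℝ → ℝ`, with `U x y t`. -/

noncomputable section

open MeasureTheory Filter Topology

/-- Functions on ℝⁿ × ℝ × ℝ, written `U x y t` for `X = (x,y)` and time `t`. -/
abbrev Fn (n : ℕ) := (Fin n → ℝ) → ℝ → ℝ → ℝ

/-- Space-time points `(x, y, t)`. -/
abbrev Pt (n : ℕ) := (Fin n → ℝ) × ℝ × ℝ

/-- Partial derivative in the direction of the i-th thin coordinate. -/
def pdx {n : ℕ} (i : Fin n) (U : Fn n) (x : Fin n → ℝ) (y t : ℝ) : ℝ :=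
  fderiv ℝ (fun x' => U x' y t) x (Pi.single i 1)

/-- Partial derivative in the extension variable y. -/
def pdy {n : ℕ} (U : Fn n) (x : Fin n → ℝ) (y t : ℝ) : ℝ :=
  deriv (fun y' => U x y' t) y

/-- Time derivative. -/
def pdt {n : ℕ} (U : Fn n) (x : Fin n → ℝ) (y t : ℝ) : ℝ :=
  deriv (fun t' => U x y t') t

/-- Squared norm |∇U|² of the full spatial gradient. -/
def gradSq {n : ℕ} (U : Fn n) (x : Fin n → ℝ) (y t : ℝ) : ℝ :=
  (∑ i, (pdx i U x y t) ^ 2) + (pdy U x y t) ^ 2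

/-- |∇V − ∇W|². -/
def gradDiffSq {n : ℕ} (V W : Fn n) (x : Fin n → ℝ) (y t : ℝ) : ℝ :=
  (∑ i, (pdx i V x y t - pdx i W x y t) ^ 2) + (pdy V x y t - pdy W x y t) ^ 2

/-- The generator Z f = ⟨X, ∇f⟩ + 2 t ∂ₜ f of the parabolic dilations. -/
def Zop {n : ℕ} (U : Fn n) (x : Fin n → ℝ) (y t : ℝ) : ℝ :=
  (∑ i, x i * pdx i U x y t) + y * pdy U x y t + 2 * t * pdt U x y t

/-- Laplacian in the x variables only. -/
def lapx {n : ℕ} (U : Fn n) (x : Fin n → ℝ) (y t : ℝ) : ℝ :=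
  ∑ i, pdx i (fun x' y' t' => pdx i U x' y' t') x y t

/-- Second derivative in y. -/
def pdyy {n : ℕ} (U : Fn n) (x : Fin n → ℝ) (y t : ℝ) : ℝ :=
  pdy (fun x' y' t' => pdy U x' y' t') x y t

/-- Full spatial Laplacian in the variables X = (x,y). -/
def lapFull {n : ℕ} (U : Fn n) (x : Fin n → ℝ) (y t : ℝ) : ℝ :=
  lapx U x y t + pdyy U x y t

/-- |X|² for X = (x,y). -/
def nsq {n : ℕ} (x : Fin n → ℝ) (y : ℝ) : ℝ := (∑ i, (x i) ^ 2) + y ^ 2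

/-- The backward Neumann fundamental solution Ḡ_a(X,t), for t < 0. -/
def Gbar (n : ℕ) (a : ℝ) (x : Fin n → ℝ) (y t : ℝ) : ℝ :=
  (4 * Real.pi) ^ (-(n : ℝ) / 2) / ((2:ℝ) ^ a * Real.Gamma ((a + 1) / 2)) *
    |t| ^ (-((n : ℝ) + a + 1) / 2) * Real.exp (-(nsq x y) / (4 * |t|))

/-- The half-strip 𝕊_r⁺ = ℝ^{n+1}_+ × (−r², 0]. -/
def Splus (n : ℕ) (r : ℝ) : Set (Pt n) :=
  {p | 0 < p.2.1 ∧ p.2.2 ∈ Set.Ioc (-(r ^ 2)) 0}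

/-- The Gaussian weight Ḡ_a(X,t) yᵃ. -/
def wgt (n : ℕ) (a : ℝ) (p : Pt n) : ℝ :=
  Gbar n a p.1 p.2.1 p.2.2 * p.2.1 ^ a

/-- The height function H(U,r). -/
def Hfn (n : ℕ) (a : ℝ) (U : Fn n) (r : ℝ) : ℝ :=
  (1 / r ^ 2) * ∫ p in Splus n r, (U p.1 p.2.1 p.2.2) ^ 2 * wgt n a p

/-- The energy D(U,r). -/
def Dfn (n : ℕ) (a : ℝ) (U : Fn n) (r : ℝ) : ℝ :=
  (1 / r ^ 2) * ∫ p in Splus n r, |p.2.2| * gradSq U p.1 p.2.1 p.2.2 * wgt n a p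

/-- The total energy I(U,r). -/
def Ifn (n : ℕ) (a : ℝ) (U : Fn n) (r : ℝ) : ℝ :=
  (1 / (2 * r ^ 2)) * ∫ p in Splus n r, U p.1 p.2.1 p.2.2 * Zop U p.1 p.2.1 p.2.2 * wgt n a p

/-- The set of thin points in S₁ where both U and its weighted normal derivative
∂_yᵃ U vanish.  The extended free boundary Γ_*(U) is its boundary in S₁. -/
def ZeroSet (n : ℕ) (a : ℝ) (U : Fn n) : Set ((Fin n → ℝ) × ℝ) :=
  {q | q.2 ∈ Set.Ioc (-1 : ℝ) 0 ∧ U q.1 0 q.2 = 0 ∧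
    Tendsto (fun y => y ^ a * pdy U q.1 y q.2) (𝓝[>] (0 : ℝ)) (𝓝 0)}

/-- The Signorini class 𝔖_F(𝕊₁⁺). -/
structure SignoriniMem (n : ℕ) (a : ℝ) (F U : Fn n) : Prop where
  /-- continuity up to the thin space -/
  cont : ContinuousOn (fun p : Pt n => U p.1 p.2.1 p.2.2)
    {p : Pt n | 0 ≤ p.2.1 ∧ p.2.2 ∈ Set.Ioc (-1 : ℝ) 0}
  /-- bounded support in the space variables -/
  bddSupp : ∃ R > (0:ℝ), ∀ x y t, R ^ 2 ≤ nsq x y → U x y t = 0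
  /-- smoothness in {y > 0} -/
  smooth : ∀ x y t, 0 < y → t ∈ Set.Ioc (-1 : ℝ) 0 →
    ContDiffAt ℝ (⊤ : ℕ∞) (fun p : Pt n => U p.1 p.2.1 p.2.2) (x, y, t)
  /-- the equation yᵃ ∂ₜU = div(yᵃ ∇U) + yᵃ F holds classically in {y > 0} -/
  pde : ∀ x y t, 0 < y → t ∈ Set.Ioc (-1 : ℝ) 0 →
    pdt U x y t = lapFull U x y t + (a / y) * pdy U x y t + F x y t
  /-- ∇ₓU extends parabolically Hölder continuously up to {y = 0} -/
  holderX : ∃ α > (0:ℝ), ∃ C : ℝ, ∀ i : Fin n, ∀ x y t x' y' t',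
    0 < y → 0 < y' → t ∈ Set.Ioc (-1 : ℝ) 0 → t' ∈ Set.Ioc (-1 : ℝ) 0 →
    |pdx i U x y t - pdx i U x' y' t'| ≤
      C * ((∑ j, (x j - x' j) ^ 2) + (y - y') ^ 2 + |t - t'|) ^ (α / 2)
  /-- yᵃ ∂_y U extends parabolically Hölder continuously up to {y = 0} -/
  holderY : ∃ α > (0:ℝ), ∃ C : ℝ, ∀ x y t x' y' t',
    0 < y → 0 < y' → t ∈ Set.Ioc (-1 : ℝ) 0 → t' ∈ Set.Ioc (-1 : ℝ) 0 →
    |y ^ a * pdy U x y t - y' ^ a * pdy U x' y' t'| ≤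
      C * ((∑ j, (x j - x' j) ^ 2) + (y - y') ^ 2 + |t - t'|) ^ (α / 2)
  /-- ∂ₜU ∈ L^∞(𝕊₁⁺) -/
  bddTime : ∃ M : ℝ, ∀ x y t, 0 < y → t ∈ Set.Ioc (-1 : ℝ) 0 → |pdt U x y t| ≤ M
  /-- yᵃ |∇ ∂ₓᵢ U|² integrable on 𝕊₁⁺ -/
  intXX : ∀ i : Fin n, IntegrableOn
    (fun p : Pt n => p.2.1 ^ a * gradSq (fun x y t => pdx i U x y t) p.1 p.2.1 p.2.2)
    (Splus n 1)
  /-- y^{−a} (∂_y(yᵃ ∂_y U))² integrable on 𝕊₁⁺ -/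
  intYY : IntegrableOn
    (fun p : Pt n => p.2.1 ^ (-a) *
      (pdy (fun x y t => y ^ a * pdy U x y t) p.1 p.2.1 p.2.2) ^ 2) (Splus n 1)
  /-- U ≥ 0 on the thin space -/
  nonneg : ∀ x, ∀ t ∈ Set.Ioc (-1 : ℝ) 0, 0 ≤ U x 0 t
  /-- the Signorini complementarity conditions on the thin space -/
  signorini : ∀ x, ∀ t ∈ Set.Ioc (-1 : ℝ) 0, ∃ L ≤ (0:ℝ),
    Tendsto (fun y => y ^ a * pdy U x y t) (𝓝[>] (0 : ℝ)) (𝓝 L) ∧ U x 0 t * L = 0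
  /-- (0,0) belongs to the extended free boundary Γ_*(U) -/
  originFB : (0, 0) ∈ closure (ZeroSet n a U) ∧
    (0, 0) ∈ closure ({q : (Fin n → ℝ) × ℝ | q.2 ∈ Set.Ioc (-1 : ℝ) 0} \ ZeroSet n a U)

/-- The growth bound |F(X,t)| ≤ C_ℓ |(X,t)|^{ℓ−2} on 𝕊₁⁺. -/
def FGrowth (n : ℕ) (F : Fn n) (l Cl : ℝ) : Prop :=
  ∀ x y t, 0 < y → t ∈ Set.Ioc (-1 : ℝ) 0 →
    |F x y t| ≤ Cl * (nsq x y + |t|) ^ ((l - 2) / 2)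

/-- The growth bound |∇_X F(X,t)| ≤ C_ℓ |(X,t)|^{ℓ−3} on 𝔹_{1/2}⁺ × (−1/4, 0]. -/
def FGradGrowth (n : ℕ) (F : Fn n) (l Cl : ℝ) : Prop :=
  ∀ x y t, 0 < y → nsq x y < (1/2 : ℝ) ^ 2 → t ∈ Set.Ioc (-(1/4 : ℝ)) 0 →
    Real.sqrt (gradSq F x y t) ≤ Cl * (nsq x y + |t|) ^ ((l - 3) / 2)

/-- The growth bound |∂ₜF(X,t)| ≤ C_ℓ |(X,t)|^{ℓ−4} on 𝔹_{1/2}⁺ × (−1/4, 0]. -/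
def FTimeGrowth (n : ℕ) (F : Fn n) (l Cl : ℝ) : Prop :=
  ∀ x y t, 0 < y → nsq x y < (1/2 : ℝ) ^ 2 → t ∈ Set.Ioc (-(1/4 : ℝ)) 0 →
    |pdt F x y t| ≤ Cl * (nsq x y + |t|) ^ ((l - 4) / 2)

/-- r ↦ log max{H(U,r), r^{2ℓ−2+2σ}}. -/
def logMaxH (n : ℕ) (a : ℝ) (U : Fn n) (l σ : ℝ) (r : ℝ) : ℝ :=
  Real.log (max (Hfn n a U r) (r ^ (2 * l - 2 + 2 * σ)))

/-- The set of radii in (0,1) where `logMaxH` is differentiable (it is locally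
Lipschitz, hence this set has full measure). -/
def diffSet (n : ℕ) (a : ℝ) (U : Fn n) (l σ : ℝ) : Set ℝ :=
  {r | r ∈ Set.Ioo (0 : ℝ) 1 ∧ DifferentiableAt ℝ (logMaxH n a U l σ) r}

/-- The truncated Almgren–Poon frequency Φ_{ℓ,σ}(U,·), with constant C. -/
def Phi (n : ℕ) (a : ℝ) (U : Fn n) (l σ C : ℝ) (r : ℝ) : ℝ :=
  (1/2) * r * Real.exp (C * r ^ (1 - σ)) * deriv (logMaxH n a U l σ) r
    + 2 * (Real.exp (C * r ^ (1 - σ)) - 1)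

/-- The parabolic Almgren rescalings U_r. -/
def rescale (n : ℕ) (a : ℝ) (U : Fn n) (r : ℝ) : Fn n :=
  fun x y t => U (r • x) (r * y) (r ^ 2 * t) / Real.sqrt (Hfn n a U r)

/-- The Weiss functional 𝒲_κ(U,r). -/
def Wfn (n : ℕ) (a : ℝ) (U : Fn n) (κ r : ℝ) : ℝ :=
  r ^ (-(2 * κ)) * (Dfn n a U r - κ / 2 * Hfn n a U r)

/-- The Monneau functional M_κ(U,p_κ,r). -/
def Mfn (n : ℕ) (a : ℝ) (U pk : Fn n) (κ r : ℝ) : ℝ :=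
  r ^ (-(2 * κ + 2)) *
    ∫ p in Splus n r, (U p.1 p.2.1 p.2.2 - pk p.1 p.2.1 p.2.2) ^ 2 * wgt n a p

/-- Polynomial functions of (x,t). -/
def IsPolyFun2 (n : ℕ) (q : (Fin n → ℝ) → ℝ → ℝ) : Prop :=
  ∃ P : MvPolynomial (Fin (n + 1)) ℝ, ∀ x t, q x t = MvPolynomial.eval (Fin.snoc x t) P

/-- Polynomial functions of (x,y,t). -/
def IsPolyFun3 (n : ℕ) (q : Fn n) : Prop :=
  ∃ P : MvPolynomial (Fin (n + 2)) ℝ, ∀ x y t,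
    q x y t = MvPolynomial.eval (Fin.snoc (Fin.snoc x y) t) P

/-- The class 𝒫_κ⁺ of parabolically κ-homogeneous, even in y, a-caloric polynomials
which are nonnegative on the thin space. -/
def Pkappa (n : ℕ) (a κ : ℝ) (p : Fn n) : Prop :=
  IsPolyFun3 n p ∧
  (∀ lam > (0:ℝ), ∀ x y t, p (lam • x) (lam * y) (lam ^ 2 * t) = lam ^ κ * p x y t) ∧
  (∀ x y t, p x (-y) t = p x y t) ∧
  (∀ x t, 0 ≤ p x 0 t) ∧
  (∀ x y t, y ≠ 0 →
    pdt p x y t - lapx p x y t - pdyy p x y t - (a / y) * pdy p x y t = 0)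

/-- The coincidence set Λ(U) ⊆ S₁. -/
def Lam (n : ℕ) (U : Fn n) : Set ((Fin n → ℝ) × ℝ) :=
  {q | q.2 ∈ Set.Ioc (-1 : ℝ) 0 ∧ U q.1 0 q.2 = 0}

/-- The thin parabolic cylinder Q_r = B_r × (−r²,0]. -/
def Qthin (n : ℕ) (r : ℝ) : Set ((Fin n → ℝ) × ℝ) :=
  {q | (∑ i, (q.1 i) ^ 2) < r ^ 2 ∧ q.2 ∈ Set.Ioc (-(r ^ 2)) 0}

/-- The modified Bessel function of the first kind I_ν(z). -/
def besselI (ν z : ℝ) : ℝ :=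
  ∑' k : ℕ, (z / 2) ^ (ν + 2 * (k : ℝ)) /
    (Real.Gamma ((k : ℝ) + 1) * Real.Gamma ((k : ℝ) + ν + 1))

/-- The Bessel heat kernel p^{(a)}(y,η,t). -/
def pker (a y η t : ℝ) : ℝ :=
  (2 * t) ^ (-(a + 1) / 2) * (y * η / (2 * t)) ^ ((1 - a) / 2) *
    besselI ((a - 1) / 2) (y * η / (2 * t)) * Real.exp (-(y ^ 2 + η ^ 2) / (4 * t))

/-- Uncurried form of a function of space-time. -/
def unc {n : ℕ} (G : Fn n) : Pt n → ℝ := fun p => G p.1 p.2.1 p.2.2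

/-- The open half-strip `{y > 0} × (−1, 0)`. -/
def openStrip (n : ℕ) : Set (Pt n) := {p | 0 < p.2.1 ∧ p.2.2 ∈ Set.Ioo (-1 : ℝ) 0}

/-- The half-space `{y > 0}`. -/
def upperHalf (n : ℕ) : Set ((Fin n → ℝ) × ℝ) := {p | 0 < p.2}

/-- The parabolic dilation `(X, −1) ↦ (sX, −s²)`. -/
def dil {n : ℕ} (s : ℝ) (p : (Fin n → ℝ) × ℝ) : Pt n := (s • p.1, s * p.2, -s ^ 2)

/-- The Gaussian weight at time `−1`. -/
def gam (n : ℕ) (a : ℝ) (p : (Fin n → ℝ) × ℝ) : ℝ := wgt n a (p.1, p.2, -1)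

lemma isOpen_openStrip (n : ℕ) : IsOpen (openStrip n) := by
  refine IsOpen.inter
    (isOpen_lt continuous_const (by fun_prop : Continuous fun p : Pt n => p.2.1)) ?_
  exact isOpen_Ioo.preimage (by fun_prop : Continuous fun p : Pt n => p.2.2)

lemma isOpen_upperHalf (n : ℕ) : IsOpen (upperHalf n) := isOpen_lt continuous_const continuous_snd

lemma dil_mem {n : ℕ} {s : ℝ} (hs : s ∈ Set.Ioo (0 : ℝ) 1) {p : (Fin n → ℝ) × ℝ}
    (hp : p ∈ upperHalf n) : dil s p ∈ openStrip n := by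
  have hp' : 0 < p.2 := hp
  refine ⟨mul_pos hs.1 hp', ?_, ?_⟩ <;> simp only [dil] <;> nlinarith [hs.1, hs.2]

section partials

variable {n : ℕ} {G : Fn n} {p : Pt n}

lemma pdx_eq_fderiv (i : Fin n) (h : DifferentiableAt ℝ (unc G) p) :
    pdx i G p.1 p.2.1 p.2.2 = fderiv ℝ (unc G) p (Pi.single i 1, 0, 0) := by
  have h1 : HasFDerivAt (fun x' : Fin n → ℝ => ((x', p.2.1, p.2.2) : Pt n))
      ((ContinuousLinearMap.id ℝ (Fin n → ℝ)).prod 0) p.1 :=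
    (hasFDerivAt_id p.1).prodMk (hasFDerivAt_const _ _)
  have h2 := HasFDerivAt.comp p.1 (g := unc G) h.hasFDerivAt h1
  unfold pdx
  rw [show (fun x' => G x' p.2.1 p.2.2) = unc G ∘ fun x' => ((x', p.2.1, p.2.2) : Pt n) from rfl,
    h2.fderiv]
  simp; rfl

lemma pdy_eq_fderiv (h : DifferentiableAt ℝ (unc G) p) :
    pdy G p.1 p.2.1 p.2.2 = fderiv ℝ (unc G) p (0, 1, 0) := by
  have h1 : HasDerivAt (fun y' : ℝ => ((p.1, y', p.2.2) : Pt n)) (0, 1, 0) p.2.1 :=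
    (hasDerivAt_const _ _).prodMk ((hasDerivAt_id _).prodMk (hasDerivAt_const _ _))
  exact (HasFDerivAt.comp_hasDerivAt (l := unc G) p.2.1 h.hasFDerivAt h1).deriv

lemma pdt_eq_fderiv (h : DifferentiableAt ℝ (unc G) p) :
    pdt G p.1 p.2.1 p.2.2 = fderiv ℝ (unc G) p (0, 0, 1) := by
  have h1 : HasDerivAt (fun t' : ℝ => ((p.1, p.2.1, t') : Pt n)) (0, 0, 1) p.2.2 :=
    (hasDerivAt_const _ _).prodMk ((hasDerivAt_const _ _).prodMk (hasDerivAt_id _))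
  exact (HasFDerivAt.comp_hasDerivAt (l := unc G) p.2.2 h.hasFDerivAt h1).deriv

lemma differentiableAt_of_smooth (h : ContDiffOn ℝ (⊤ : ℕ∞) (unc G) (openStrip n))
    (hp : p ∈ openStrip n) : DifferentiableAt ℝ (unc G) p :=
  (h.contDiffAt ((isOpen_openStrip n).mem_nhds hp)).differentiableAt (by simp)

lemma contDiffOn_fderiv_apply (h : ContDiffOn ℝ (⊤ : ℕ∞) (unc G) (openStrip n)) (v : Pt n) :
    ContDiffOn ℝ (⊤ : ℕ∞) (fun p => fderiv ℝ (unc G) p v) (openStrip n) :=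
  (h.fderiv_of_isOpen (isOpen_openStrip n) (by simp)).clm_apply contDiffOn_const

lemma contDiffOn_pdx (i : Fin n) (h : ContDiffOn ℝ (⊤ : ℕ∞) (unc G) (openStrip n)) :
    ContDiffOn ℝ (⊤ : ℕ∞) (unc (pdx i G)) (openStrip n) :=
  (contDiffOn_fderiv_apply h _).congr fun _ hp =>
    pdx_eq_fderiv i (differentiableAt_of_smooth h hp)

lemma contDiffOn_pdy (h : ContDiffOn ℝ (⊤ : ℕ∞) (unc G) (openStrip n)) :
    ContDiffOn ℝ (⊤ : ℕ∞) (unc (pdy G)) (openStrip n) :=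
  (contDiffOn_fderiv_apply h _).congr fun _ hp =>
    pdy_eq_fderiv (differentiableAt_of_smooth h hp)

lemma contDiffOn_pdt (h : ContDiffOn ℝ (⊤ : ℕ∞) (unc G) (openStrip n)) :
    ContDiffOn ℝ (⊤ : ℕ∞) (unc (pdt G)) (openStrip n) :=
  (contDiffOn_fderiv_apply h _).congr fun _ hp =>
    pdt_eq_fderiv (differentiableAt_of_smooth h hp)

lemma contDiffOn_Zop (h : ContDiffOn ℝ (⊤ : ℕ∞) (unc G) (openStrip n)) :
    ContDiffOn ℝ (⊤ : ℕ∞) (unc (Zop G)) (openStrip n) := by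
  have hx := fun i => contDiffOn_pdx i h
  have hy := contDiffOn_pdy h
  have ht := contDiffOn_pdt h
  unfold unc at hx hy ht ⊢
  unfold Zop
  refine ((ContDiffOn.sum fun i _ => ContDiffOn.mul ?_ (hx i)).add (ContDiffOn.mul ?_ hy)).add
    (ContDiffOn.mul ?_ ht)
  all_goals exact ContDiff.contDiffOn (by fun_prop)

lemma contDiffOn_dil (h : ContDiffOn ℝ (⊤ : ℕ∞) (unc G) (openStrip n)) {s : ℝ}
    (hs : s ∈ Set.Ioo (0 : ℝ) 1) :
    ContDiffOn ℝ (⊤ : ℕ∞) (fun q => unc G (dil s q)) (upperHalf n) := by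
  refine h.comp (ContDiff.contDiffOn ?_) fun q hq => dil_mem hs hq
  unfold dil; fun_prop

lemma hasFDerivAt_dil (s : ℝ) (q : (Fin n → ℝ) × ℝ) :
    HasFDerivAt (dil (n := n) s)
      ((s • ContinuousLinearMap.fst ℝ (Fin n → ℝ) ℝ).prod
        ((s • ContinuousLinearMap.snd ℝ (Fin n → ℝ) ℝ).prod 0)) q :=
  (hasFDerivAt_fst.const_smul s).prodMk
    ((hasFDerivAt_snd.const_smul s).prodMk (hasFDerivAt_const _ _))

lemma fderiv_dil_x (i : Fin n) {s : ℝ} {q : (Fin n → ℝ) × ℝ}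
    (h : DifferentiableAt ℝ (unc G) (dil s q)) :
    fderiv ℝ (fun q => unc G (dil s q)) q (Pi.single i 1, 0) = s * unc (pdx i G) (dil s q) := by
  have h2 := HasFDerivAt.comp q (g := unc G) h.hasFDerivAt (hasFDerivAt_dil s q)
  rw [show (fun q => unc G (dil s q)) = unc G ∘ dil s from rfl, h2.fderiv]
  rw [unc, pdx_eq_fderiv i h, ← smul_eq_mul, ← map_smul]
  simp

lemma fderiv_dil_y {s : ℝ} {q : (Fin n → ℝ) × ℝ}
    (h : DifferentiableAt ℝ (unc G) (dil s q)) :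
    fderiv ℝ (fun q => unc G (dil s q)) q (0, 1) = s * unc (pdy G) (dil s q) := by
  have h2 := HasFDerivAt.comp q (g := unc G) h.hasFDerivAt (hasFDerivAt_dil s q)
  rw [show (fun q => unc G (dil s q)) = unc G ∘ dil s from rfl, h2.fderiv]
  rw [unc, pdy_eq_fderiv h, ← smul_eq_mul, ← map_smul]
  simp

lemma hasDerivAt_dil_s {s : ℝ} (hs : s ≠ 0) {q : (Fin n → ℝ) × ℝ}
    (h : DifferentiableAt ℝ (unc G) (dil s q)) :
    HasDerivAt (fun s => unc G (dil s q)) (s⁻¹ * unc (Zop G) (dil s q)) s := by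
  have h1 : HasDerivAt (fun s : ℝ => dil s q) (q.1, q.2, -(2 * s)) s := by
    refine HasDerivAt.prodMk ?_ (HasDerivAt.prodMk ?_ ?_)
    · simpa using (hasDerivAt_id s).smul_const q.1
    · simpa using (hasDerivAt_id s).mul_const q.2
    · simpa using (hasDerivAt_pow 2 s).fun_neg
  have h2 := HasFDerivAt.comp_hasDerivAt (l := unc G) s h.hasFDerivAt h1
  refine h2.congr_deriv ?_
  have hd : ((q.1, q.2, -(2 * s)) : Pt n) = (∑ i, q.1 i • ((Pi.single i 1, 0, 0) : Pt n))
      + q.2 • (0, 1, 0) + (-(2 * s)) • (0, 0, 1) := by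
    ext
    · simp [Prod.fst_sum, Finset.sum_apply, Pi.single_apply]
    · simp [Prod.snd_sum]
    · simp [Prod.snd_sum]
  rw [hd, map_add, map_add, map_sum]
  simp only [map_smul, smul_eq_mul]
  rw [show unc (Zop G) (dil s q) = Zop G (dil s q).1 (dil s q).2.1 (dil s q).2.2 from rfl, Zop,
    pdy_eq_fderiv h, pdt_eq_fderiv h]
  simp_rw [fun i => pdx_eq_fderiv i h]
  simp only [dil, Pi.smul_apply, smul_eq_mul]
  rw [mul_add, mul_add, Finset.mul_sum]
  congr 1
  · congr 1
    · refine Finset.sum_congr rfl fun i _ => ?_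
      field_simp
    · field_simp
  · field_simp

end partials

section weight

variable {n : ℕ} {a : ℝ}

/-- The normalisation constant of `Gbar`. -/
def gcst (n : ℕ) (a : ℝ) : ℝ :=
  (4 * Real.pi) ^ (-(n : ℝ) / 2) / ((2:ℝ) ^ a * Real.Gamma ((a + 1) / 2))

lemma gcst_nonneg (n : ℕ) (ha₁ : -1 < a) : 0 ≤ gcst n a := by
  have : 0 < Real.Gamma ((a + 1) / 2) := Real.Gamma_pos_of_pos (by linarith)
  unfold gcst; positivity

lemma gam_eq (q : (Fin n → ℝ) × ℝ) :
    gam n a q = gcst n a * Real.exp (-(nsq q.1 q.2) / 4) * q.2 ^ a := by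
  simp [gam, wgt, Gbar, gcst]

lemma gam_nonneg (ha₁ : -1 < a) {q : (Fin n → ℝ) × ℝ} (hq : q ∈ upperHalf n) : 0 ≤ gam n a q := by
  have := gcst_nonneg n ha₁
  have := Real.rpow_nonneg (le_of_lt (show 0 < q.2 from hq)) a
  rw [gam_eq]; positivity

lemma nsq_smul (s : ℝ) (x : Fin n → ℝ) (y : ℝ) : nsq (s • x) (s * y) = s ^ 2 * nsq x y := by
  simp [nsq, mul_pow, mul_add, Finset.mul_sum]

lemma wgt_dil {s : ℝ} (hs : 0 < s) {q : (Fin n → ℝ) × ℝ} (hq : q ∈ upperHalf n) :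
    s ^ (n + 1) * wgt n a (dil s q) = gam n a q := by
  have hy : 0 < q.2 := hq
  rw [gam_eq, wgt, Gbar]
  simp only [dil]
  rw [nsq_smul, abs_neg, abs_of_pos (by positivity : 0 < s ^ 2), Real.mul_rpow hs.le hy.le,
    ← Real.rpow_natCast s 2, ← Real.rpow_mul hs.le, ← Real.rpow_natCast s (n + 1)]
  have h1 : -(s ^ ((2:ℕ):ℝ) * nsq q.1 q.2) / (4 * s ^ ((2:ℕ):ℝ)) = -(nsq q.1 q.2) / 4 := by
    have : s ^ ((2:ℕ):ℝ) ≠ 0 := (Real.rpow_pos_of_pos hs _).ne'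
    field_simp
  have h2 : s ^ (((n + 1 : ℕ)) : ℝ) * (s ^ (((2 : ℕ) : ℝ) * (-((n : ℝ) + a + 1) / 2)) * s ^ a)
      = 1 := by
    rw [← Real.rpow_add hs, ← Real.rpow_add hs]
    convert Real.rpow_zero s using 2
    push_cast; ring
  rw [h1, ← gcst]
  linear_combination (gcst n a * Real.exp (-(nsq q.1 q.2) / 4) * q.2 ^ a) * h2

lemma exp_nsq (x : Fin n → ℝ) (y : ℝ) :
    Real.exp (-(nsq x y) / 4)
      = (∏ i, Real.exp (-(1 / 4) * (x i) ^ 2)) * Real.exp (-(1 / 4) * y ^ 2) := by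
  rw [← Real.exp_sum, ← Real.exp_add, ← Finset.mul_sum, nsq]
  congr 1; ring

lemma integrable_gaussian_x (n : ℕ) :
    Integrable fun x : Fin n → ℝ => ∏ i, Real.exp (-(1 / 4) * (x i) ^ 2) :=
  Integrable.fintype_prod (f := fun _ (t : ℝ) => Real.exp (-(1 / 4) * t ^ 2))
    fun _ => integrable_exp_neg_mul_sq (by norm_num)

lemma upperHalf_eq (n : ℕ) : upperHalf n = Set.univ ×ˢ Set.Ioi (0 : ℝ) := by ext; simp [upperHalf]

/-- The weight dominating all integrands. -/
def dom (n : ℕ) (a : ℝ) (q : (Fin n → ℝ) × ℝ) : ℝ := (1 + q.2 ^ (-(2 * a))) * gam n a q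

lemma integrableOn_dom (ha₁ : -1 < a) (ha₂ : a < 1) :
    IntegrableOn (dom n a) (upperHalf n) := by
  have hy : IntegrableOn (fun y : ℝ => gcst n a * (y ^ a * Real.exp (-(1 / 4) * y ^ 2)
      + y ^ (-a) * Real.exp (-(1 / 4) * y ^ 2))) (Set.Ioi 0) :=
    ((integrableOn_rpow_mul_exp_neg_mul_sq (by norm_num) ha₁).add
      (integrableOn_rpow_mul_exp_neg_mul_sq (by norm_num) (by linarith))).const_mul _
  have h := (integrable_gaussian_x n).integrableOn (s := Set.univ) |>.mul_prod hy
  rw [Measure.prod_restrict, ← Measure.volume_eq_prod, ← upperHalf_eq] at h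
  refine IntegrableOn.congr_fun h (fun q hq => ?_) (isOpen_upperHalf n).measurableSet
  have hy : 0 < q.2 := hq
  have : q.2 ^ (-a) = q.2 ^ (-(2 * a)) * q.2 ^ a := by
    rw [← Real.rpow_add hy]; congr 1; ring
  simp only [dom, gam_eq, exp_nsq, this]
  ring

lemma gam_le_dom (ha₁ : -1 < a) {q : (Fin n → ℝ) × ℝ} (hq : q ∈ upperHalf n) :
    gam n a q ≤ dom n a q := by
  have := gam_nonneg ha₁ hq
  have := Real.rpow_nonneg (le_of_lt (show 0 < q.2 from hq)) (-(2 * a))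
  unfold dom; nlinarith

lemma contDiff_nsq : ContDiff ℝ (⊤ : ℕ∞) fun q : (Fin n → ℝ) × ℝ => nsq q.1 q.2 := by
  unfold nsq; fun_prop

lemma contDiffOn_gam : ContDiffOn ℝ (⊤ : ℕ∞) (gam n a) (upperHalf n) := by
  have : gam n a = fun q => gcst n a * Real.exp (-(nsq q.1 q.2) / 4) * q.2 ^ a := by
    ext q; exact gam_eq q
  rw [this]
  refine ContDiffOn.mul (ContDiff.contDiffOn ?_) ?_
  · exact contDiff_const.mul ((contDiff_nsq.neg.div_const _).exp)
  · exact contDiff_snd.contDiffOn.rpow_const_of_ne fun q hq => (ne_of_gt hq)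

lemma fderiv_gam {q : (Fin n → ℝ) × ℝ} (hq : q ∈ upperHalf n) (v : (Fin n → ℝ) × ℝ) :
    fderiv ℝ (gam n a) q v
      = (-(∑ i, q.1 i * v.1 i) / 2 + (a / q.2 - q.2 / 2) * v.2) * gam n a q := by
  have hy : 0 < q.2 := hq
  have hd : DifferentiableAt ℝ (gam n a) q :=
    (contDiffOn_gam.contDiffAt ((isOpen_upperHalf n).mem_nhds hq)).differentiableAt (by simp)
  have hl : HasDerivAt (fun τ : ℝ => q + τ • v) v 0 := by
    simpa using ((hasDerivAt_id (0 : ℝ)).smul_const v).const_add q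
  have h1 := HasFDerivAt.comp_hasDerivAt_of_eq (l := gam n a) (0 : ℝ) hd.hasFDerivAt hl (by simp)
  refine h1.unique ?_
  have hN : HasDerivAt (fun τ : ℝ => nsq (q + τ • v).1 (q + τ • v).2)
      (2 * (∑ i, q.1 i * v.1 i) + 2 * q.2 * v.2) 0 := by
    have hx : ∀ i ∈ Finset.univ, HasDerivAt (fun τ : ℝ => (q.1 i + τ * v.1 i) ^ 2)
        (2 * (q.1 i * v.1 i)) 0 := fun i _ => by
      have := (((hasDerivAt_id (0:ℝ)).mul_const (v.1 i)).const_add (q.1 i)).pow 2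
      refine this.congr_deriv ?_
      simp; ring
    have hy : HasDerivAt (fun τ : ℝ => (q.2 + τ * v.2) ^ 2) (2 * q.2 * v.2) 0 := by
      have := (((hasDerivAt_id (0:ℝ)).mul_const v.2).const_add q.2).pow 2
      refine this.congr_deriv ?_
      simp
    have := (HasDerivAt.fun_sum hx).add hy
    rw [← Finset.mul_sum] at this
    exact this
  have hY : HasDerivAt (fun τ : ℝ => (q + τ • v).2 ^ a) (v.2 * a * q.2 ^ (a - 1)) 0 := by
    have h0 : HasDerivAt (fun τ : ℝ => (q + τ • v).2) v.2 0 := by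
      simpa using ((hasDerivAt_id (0:ℝ)).mul_const v.2).const_add q.2
    simpa using h0.rpow_const (p := a) (Or.inl (by simpa using hy.ne'))
  have hA := ((((hN.fun_neg.div_const 4).exp).const_mul (gcst n a)).fun_mul hY)
  have he : (gam n a ∘ fun τ : ℝ => q + τ • v) = fun τ : ℝ => gcst n a *
      Real.exp (-(nsq (q + τ • v).1 (q + τ • v).2) / 4) * (q + τ • v).2 ^ a := by
    ext τ; exact gam_eq _
  rw [he]
  refine hA.congr_deriv ?_
  rw [gam_eq, Real.rpow_sub_one hy.ne']
  simp only [zero_smul, add_zero]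
  field_simp
  ring

end weight

section polar

variable {n : ℕ} {a : ℝ}

/-- The differential of `(q, s) ↦ (s q, −s²)`. -/
def dilDeriv (n : ℕ) (z : ((Fin n → ℝ) × ℝ) × ℝ) :
    (((Fin n → ℝ) × ℝ) × ℝ) →L[ℝ] (((Fin n → ℝ) × ℝ) × ℝ) :=
  (z.2 • ContinuousLinearMap.fst ℝ ((Fin n → ℝ) × ℝ) ℝ
      + (ContinuousLinearMap.snd ℝ ((Fin n → ℝ) × ℝ) ℝ).smulRight z.1).prod
    ((-(2 * z.2)) • ContinuousLinearMap.snd ℝ ((Fin n → ℝ) × ℝ) ℝ)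

lemma hasFDerivAt_dilMap (z : ((Fin n → ℝ) × ℝ) × ℝ) :
    HasFDerivAt (fun z : ((Fin n → ℝ) × ℝ) × ℝ => (z.2 • z.1, -z.2 ^ 2)) (dilDeriv n z) z := by
  refine HasFDerivAt.prodMk ?_ ?_
  · have h1 : HasFDerivAt (fun z : ((Fin n → ℝ) × ℝ) × ℝ => z.2)
        (ContinuousLinearMap.snd ℝ ((Fin n → ℝ) × ℝ) ℝ) z := hasFDerivAt_snd
    have h2 : HasFDerivAt (fun z : ((Fin n → ℝ) × ℝ) × ℝ => z.1)
        (ContinuousLinearMap.fst ℝ ((Fin n → ℝ) × ℝ) ℝ) z := hasFDerivAt_fst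
    exact h1.fun_smul h2
  · refine ((hasFDerivAt_snd (p := z)).pow 2).fun_neg.congr_fderiv ?_
    ext <;> simp

lemma det_dilDeriv {z : ((Fin n → ℝ) × ℝ) × ℝ} (hz : 0 < z.2) :
    |(dilDeriv n z).det| = 2 * z.2 * z.2 ^ (n + 1) := by
  have hfac : (dilDeriv n z : (((Fin n → ℝ) × ℝ) × ℝ) →ₗ[ℝ] (((Fin n → ℝ) × ℝ) × ℝ)) =
      (LinearMap.prodMap (z.2 • LinearMap.id) ((-(2 * z.2)) • LinearMap.id)) ∘ₗ
        LinearMap.transvection (LinearMap.snd ℝ ((Fin n → ℝ) × ℝ) ℝ) (z.2⁻¹ • z.1, (0 : ℝ)) := by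
    refine LinearMap.ext fun w => ?_
    refine Prod.ext ?_ ?_
    · have : z.2 * (w.2 * z.2⁻¹) = w.2 := by field_simp
      simp [dilDeriv, LinearMap.transvection, smul_smul, this]
    · simp [dilDeriv, LinearMap.transvection]
  rw [ContinuousLinearMap.det, hfac, LinearMap.det_comp, LinearMap.det_prodMap,
    LinearMap.transvection.det]
  simp [abs_mul, abs_of_pos hz]
  ring

lemma image_dilMap {r : ℝ} (hr : 0 < r) :
    (fun z : ((Fin n → ℝ) × ℝ) × ℝ => (z.2 • z.1, -z.2 ^ 2)) '' (upperHalf n ×ˢ Set.Ioo 0 r)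
      = upperHalf n ×ˢ Set.Ioo (-r ^ 2) 0 := by
  ext w
  constructor
  · rintro ⟨z, ⟨hz1, hz2, hz3⟩, rfl⟩
    exact ⟨mul_pos hz2 hz1, by simp only; nlinarith, by simp only; nlinarith⟩
  · rintro ⟨hw1, hw2, hw3⟩
    have hs : 0 < √(-w.2) := Real.sqrt_pos.2 (by linarith)
    have hq : √(-w.2) ^ 2 = -w.2 := Real.sq_sqrt (by linarith)
    refine ⟨((√(-w.2))⁻¹ • w.1, √(-w.2)), ⟨mul_pos (inv_pos.2 hs) hw1, hs, ?_⟩, ?_⟩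
    · simp only
      rw [Real.sqrt_lt' hr]; linarith
    · refine Prod.ext ?_ ?_
      · simp [smul_smul, hs.ne']
      · simp only [hq, neg_neg]

lemma injOn_dilMap {r : ℝ} :
    Set.InjOn (fun z : ((Fin n → ℝ) × ℝ) × ℝ => (z.2 • z.1, -z.2 ^ 2))
      (upperHalf n ×ˢ Set.Ioo 0 r) := by
  rintro ⟨q, s⟩ ⟨-, hs, -⟩ ⟨q', s'⟩ ⟨-, hs', -⟩ h
  simp only at hs hs' h
  obtain ⟨h1, h2⟩ := Prod.mk.inj h
  have : s = s' := by
    have h3 : s ^ 2 = s' ^ 2 := by linarith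
    exact (pow_left_inj₀ hs.le hs'.le two_ne_zero).1 h3
  subst this
  rw [smul_right_injective _ hs.ne' h1]

/-- Integration over `Splus n r` in self-similar coordinates. -/
lemma setIntegral_Splus (ha₁ : -1 < a) (ha₂ : a < 1) {g : Pt n → ℝ} {C r : ℝ}
    (hg : ContinuousOn g (openStrip n))
    (hb : ∀ s ∈ Set.Ioo (0 : ℝ) 1, ∀ q ∈ upperHalf n,
      |g (dil s q)| ≤ C * (1 + q.2 ^ (-(2 * a))))
    (hr : r ∈ Set.Ioo (0 : ℝ) 1) :
    IntervalIntegrable (fun s => 2 * s * ∫ q in upperHalf n, g (dil s q) * gam n a q)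
      volume 0 r ∧
    ∫ p in Splus n r, g p * wgt n a p
      = ∫ s in (0 : ℝ)..r, 2 * s * ∫ q in upperHalf n, g (dil s q) * gam n a q := by
  obtain ⟨hr0, hr1⟩ := hr
  set h : Pt n → ℝ := fun p => g p * wgt n a p
  set S : Set (((Fin n → ℝ) × ℝ) × ℝ) := upperHalf n ×ˢ Set.Ioo 0 r
  have hS : MeasurableSet S := (isOpen_upperHalf n).measurableSet.prod measurableSet_Ioo
  set k : ((Fin n → ℝ) × ℝ) × ℝ → ℝ := fun z => 2 * z.2 * (g (dil z.2 z.1) * gam n a z.1)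
  have hsub : ∀ z ∈ S, z.2 ∈ Set.Ioo (0 : ℝ) 1 := fun z hz => ⟨hz.2.1, hz.2.2.trans hr1⟩
  have step1 : ∫ p in Splus n r, h p
      = ∫ z in upperHalf n ×ˢ Set.Ioo (-r ^ 2) 0, h (MeasurableEquiv.prodAssoc z) := by
    have hmp : MeasurePreserving
        (MeasurableEquiv.prodAssoc : ((Fin n → ℝ) × ℝ) × ℝ ≃ᵐ Pt n) := volume_preserving_prodAssoc
    rw [← hmp.setIntegral_preimage_emb (MeasurableEquiv.measurableEmbedding _)]
    have hpre : (MeasurableEquiv.prodAssoc : ((Fin n → ℝ) × ℝ) × ℝ ≃ᵐ Pt n) ⁻¹' (Splus n r)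
        = upperHalf n ×ˢ Set.Ioc (-r ^ 2) 0 := rfl
    rw [hpre]
    exact setIntegral_congr_set (Measure.set_prod_ae_eq (ae_eq_refl _) Ioo_ae_eq_Ioc.symm)
  have step2 : ∫ z in upperHalf n ×ˢ Set.Ioo (-r ^ 2) 0, h (MeasurableEquiv.prodAssoc z)
      = ∫ z in S, k z := by
    have hm₁ : (volume : Measure ((Fin n → ℝ) × ℝ)).IsAddHaarMeasure := by
      rw [Measure.volume_eq_prod]; infer_instance
    have hm₂ : (volume : Measure (((Fin n → ℝ) × ℝ) × ℝ)).IsAddHaarMeasure := by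
      rw [Measure.volume_eq_prod]; infer_instance
    rw [← image_dilMap hr0, integral_image_eq_integral_abs_det_fderiv_smul volume hS
      (fun z _ => (hasFDerivAt_dilMap z).hasFDerivWithinAt) injOn_dilMap]
    refine setIntegral_congr_fun hS fun z hz => ?_
    have hz2 := (hsub z hz).1
    simp only [smul_eq_mul]
    rw [det_dilDeriv hz2]
    change 2 * z.2 * z.2 ^ (n + 1) * (g (dil z.2 z.1) * wgt n a (dil z.2 z.1)) = _
    simp only [k]
    rw [← wgt_dil hz2 hz.1]
    ring
  have hcd : ContinuousOn (fun z : ((Fin n → ℝ) × ℝ) × ℝ => dil z.2 z.1) S := by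
    unfold dil; fun_prop
  have hkc : ContinuousOn k S := by
    refine ContinuousOn.mul (by fun_prop) (ContinuousOn.mul ?_ ?_)
    · exact hg.comp hcd fun z hz => dil_mem (hsub z hz) hz.1
    · exact contDiffOn_gam.continuousOn.comp continuousOn_fst fun z hz => hz.1
  have hdom : Integrable (fun z : ((Fin n → ℝ) × ℝ) × ℝ => dom n a z.1 * (2 * C))
      (volume.restrict S) := by
    have hc : IntegrableOn (fun _ : ℝ => 2 * C) (Set.Ioo 0 r) :=
      integrableOn_const (by simp)
    have := (integrableOn_dom (n := n) ha₁ ha₂).mul_prod hc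
    rwa [Measure.prod_restrict, ← Measure.volume_eq_prod] at this
  have hk : Integrable k (volume.restrict S) := by
    refine hdom.mono' (hkc.aestronglyMeasurable hS) ?_
    refine (ae_restrict_iff' hS).2 (Eventually.of_forall fun z hz => ?_)
    have h1 := hsub z hz
    have h2 := hb z.2 h1 z.1 hz.1
    have h3 := gam_nonneg (a := a) ha₁ hz.1
    rw [Real.norm_eq_abs, abs_mul, abs_of_pos (by linarith [h1.1] : 0 < 2 * z.2), abs_mul,
      abs_of_nonneg h3]
    have h4 : |g (dil z.2 z.1)| * gam n a z.1 ≤ C * dom n a z.1 := by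
      calc _ ≤ C * (1 + z.1.2 ^ (-(2 * a))) * gam n a z.1 := mul_le_mul_of_nonneg_right h2 h3
        _ = _ := by rw [dom]; ring
    have h5 : 0 ≤ |g (dil z.2 z.1)| * gam n a z.1 := mul_nonneg (abs_nonneg _) h3
    nlinarith [h1.1, h1.2]
  have hprod : volume.restrict S
      = (volume.restrict (upperHalf n)).prod (volume.restrict (Set.Ioo 0 r)) := by
    rw [Measure.prod_restrict, ← Measure.volume_eq_prod]
  rw [hprod] at hk
  have hslice : ∀ s, ∫ q in upperHalf n, k (q, s)
      = 2 * s * ∫ q in upperHalf n, g (dil s q) * gam n a q := fun s =>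
    integral_const_mul (2 * s) fun q => g (dil s q) * gam n a q
  constructor
  · rw [intervalIntegrable_iff_integrableOn_Ioo_of_le hr0.le]
    have := hk.integral_prod_right
    simp_rw [hslice] at this
    exact this
  · rw [step1, step2, hprod, integral_prod_symm _ hk,
      intervalIntegral.integral_of_le hr0.le, integral_Ioc_eq_integral_Ioo]
    simp_rw [hslice]

end polar

section divergence

variable {n : ℕ}

lemma continuous_nsq : Continuous fun q : (Fin n → ℝ) × ℝ => nsq q.1 q.2 :=
  contDiff_nsq.continuous

lemma sq_le_nsq_x (x : Fin n → ℝ) (y : ℝ) (i : Fin n) : x i ^ 2 ≤ nsq x y := by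
  have := Finset.single_le_sum (f := fun i => x i ^ 2) (fun i _ => sq_nonneg (x i))
    (Finset.mem_univ i)
  unfold nsq
  nlinarith [sq_nonneg y]

lemma sq_le_nsq_y (x : Fin n → ℝ) (y : ℝ) : y ^ 2 ≤ nsq x y := by
  have := Finset.sum_nonneg fun (i : Fin n) (_ : i ∈ Finset.univ) => sq_nonneg (x i)
  unfold nsq
  linarith

lemma norm_le_of_nsq_le {x : Fin n → ℝ} {y R : ℝ} (h : nsq x y ≤ R ^ 2) : ‖x‖ ≤ |R| := by
  refine (pi_norm_le_iff_of_nonneg (abs_nonneg R)).2 fun i => ?_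
  exact sq_le_sq.1 ((sq_le_nsq_x x y i).trans h)

lemma isCompact_cut (R ε : ℝ) :
    IsCompact {q : (Fin n → ℝ) × ℝ | nsq q.1 q.2 ≤ R ^ 2 ∧ ε ≤ q.2} := by
  refine Metric.isCompact_of_isClosed_isBounded ?_ ?_
  · exact (isClosed_le continuous_nsq continuous_const).inter
      (isClosed_le continuous_const continuous_snd)
  · refine (Metric.isBounded_closedBall (x := 0) (r := |R|)).subset fun q hq => ?_
    rw [mem_closedBall_zero_iff, Prod.norm_def]
    exact max_le (norm_le_of_nsq_le hq.1) (sq_le_sq.1 ((sq_le_nsq_y q.1 q.2).trans hq.1))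

lemma integrableOn_of_bddSupport {f : (Fin n → ℝ) × ℝ → ℝ} {R ε : ℝ} (hε : 0 < ε)
    (hf : ContinuousOn f (upperHalf n))
    (h0 : ∀ q ∈ upperHalf n, R ^ 2 < nsq q.1 q.2 → f q = 0) :
    IntegrableOn f (Set.univ ×ˢ Set.Ioi ε) := by
  have hK : IntegrableOn f {q : (Fin n → ℝ) × ℝ | nsq q.1 q.2 ≤ R ^ 2 ∧ ε ≤ q.2} :=
    (hf.mono fun q hq => lt_of_lt_of_le hε hq.2).integrableOn_compact (isCompact_cut R ε)
  refine hK.of_forall_sdiff_eq_zero (MeasurableSet.univ.prod measurableSet_Ioi) ?_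
  rintro q ⟨⟨-, hq⟩, hq'⟩
  have hq : ε < q.2 := hq
  refine h0 q (hε.trans hq) ?_
  by_contra hc
  exact hq' ⟨not_lt.1 hc, hq.le⟩

lemma fderiv_eq_zero_of_bddSupport {f : (Fin n → ℝ) × ℝ → ℝ} {R : ℝ}
    (h0 : ∀ q ∈ upperHalf n, R ^ 2 < nsq q.1 q.2 → f q = 0) {q : (Fin n → ℝ) × ℝ}
    (hq : q ∈ upperHalf n) (hR : R ^ 2 < nsq q.1 q.2) : fderiv ℝ f q = 0 := by
  have : f =ᶠ[𝓝 q] fun _ => 0 := by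
    filter_upwards [(isOpen_upperHalf n).mem_nhds hq,
      (isOpen_lt continuous_const continuous_nsq).mem_nhds hR] with q' h1 h2 using h0 q' h1 h2
  rw [this.fderiv_eq]; simp

lemma continuousOn_fderiv_apply {f : (Fin n → ℝ) × ℝ → ℝ}
    (hf : ContDiffOn ℝ (⊤ : ℕ∞) f (upperHalf n)) (v : (Fin n → ℝ) × ℝ) :
    ContinuousOn (fun q => fderiv ℝ f q v) (upperHalf n) :=
  (hf.continuousOn_fderiv_of_isOpen (isOpen_upperHalf n) (by simp)).clm_apply continuousOn_const

lemma integrableOn_fderiv {f : (Fin n → ℝ) × ℝ → ℝ} {R ε : ℝ} (hε : 0 < ε)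
    (hf : ContDiffOn ℝ (⊤ : ℕ∞) f (upperHalf n))
    (h0 : ∀ q ∈ upperHalf n, R ^ 2 < nsq q.1 q.2 → f q = 0) (v : (Fin n → ℝ) × ℝ) :
    IntegrableOn (fun q => fderiv ℝ f q v) (Set.univ ×ˢ Set.Ioi ε) :=
  integrableOn_of_bddSupport (R := R) hε (continuousOn_fderiv_apply hf v) fun q hq hR => by
    rw [fderiv_eq_zero_of_bddSupport h0 hq hR]; rfl

lemma differentiableAt_upperHalf {f : (Fin n → ℝ) × ℝ → ℝ}
    (hf : ContDiffOn ℝ (⊤ : ℕ∞) f (upperHalf n)) {q : (Fin n → ℝ) × ℝ} (hq : q ∈ upperHalf n) :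
    DifferentiableAt ℝ f q :=
  (hf.contDiffAt ((isOpen_upperHalf n).mem_nhds hq)).differentiableAt (by simp)

lemma integral_fderiv_x {f : (Fin n → ℝ) × ℝ → ℝ} {R ε : ℝ} (hε : 0 < ε)
    (hf : ContDiffOn ℝ (⊤ : ℕ∞) f (upperHalf n))
    (h0 : ∀ q ∈ upperHalf n, R ^ 2 < nsq q.1 q.2 → f q = 0) (i : Fin n) :
    ∫ q in Set.univ ×ˢ Set.Ioi ε, fderiv ℝ f q (Pi.single i 1, 0) = 0 := by
  have hint := integrableOn_fderiv hε hf h0 (Pi.single i 1, 0)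
  rw [IntegrableOn, Measure.volume_eq_prod, ← Measure.prod_restrict] at hint
  rw [Measure.volume_eq_prod, ← Measure.prod_restrict, integral_prod_symm _ hint,
    Measure.restrict_univ]
  refine setIntegral_eq_zero_of_forall_eq_zero fun y hy => ?_
  have hy0 : 0 < y := hε.trans hy
  have hd : ∀ x, HasFDerivAt (fun x => f (x, y))
      ((fderiv ℝ f (x, y)).comp ((ContinuousLinearMap.id ℝ (Fin n → ℝ)).prod 0)) x := fun x =>
    HasFDerivAt.comp (f := fun x => (x, y)) x
      (differentiableAt_upperHalf hf (q := (x, y)) hy0).hasFDerivAt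
      ((hasFDerivAt_id x).prodMk (hasFDerivAt_const _ _))
  have hfd : ∀ x, fderiv ℝ (fun x => f (x, y)) x (Pi.single i 1)
      = fderiv ℝ f (x, y) (Pi.single i 1, 0) := fun x => by
    rw [(hd x).fderiv]; simp
  have hmem : ∀ x : Fin n → ℝ, (x, y) ∈ upperHalf n := fun x => hy0
  have hout : ∀ x, x ∉ Metric.closedBall (0 : Fin n → ℝ) |R| → R ^ 2 < nsq x y := fun x hx => by
    by_contra hc
    exact hx (mem_closedBall_zero_iff.2 (norm_le_of_nsq_le (not_lt.1 hc)))
  have hi1 : Integrable fun x => f (x, y) := by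
    refine Continuous.integrable_of_hasCompactSupport ?_
      (HasCompactSupport.intro (isCompact_closedBall 0 |R|) fun x hx => h0 _ hy0 (hout x hx))
    exact hf.continuousOn.comp_continuous (by fun_prop) hmem
  have hi2 : Integrable fun x => fderiv ℝ f (x, y) (Pi.single i 1, 0) := by
    refine Continuous.integrable_of_hasCompactSupport ?_
      (HasCompactSupport.intro (isCompact_closedBall 0 |R|) fun x hx => ?_)
    · exact (continuousOn_fderiv_apply hf (Pi.single i 1, 0)).comp_continuous (by fun_prop) hmem
    · rw [fderiv_eq_zero_of_bddSupport h0 (hmem x) (hout x hx)]; rfl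
  have := integral_mul_fderiv_eq_neg_fderiv_mul_of_integrable (μ := volume)
    (f := fun _ : Fin n → ℝ => (1 : ℝ)) (g := fun x => f (x, y)) (v := Pi.single i 1)
    (by simp) (by simpa [hfd] using hi2) (by simpa using hi1) (by fun_prop)
    (fun x _ => (hd x).differentiableAt)
  simpa [hfd] using this

lemma integral_fderiv_y {f : (Fin n → ℝ) × ℝ → ℝ} {R ε : ℝ} (hε : 0 < ε)
    (hf : ContDiffOn ℝ (⊤ : ℕ∞) f (upperHalf n))
    (h0 : ∀ q ∈ upperHalf n, R ^ 2 < nsq q.1 q.2 → f q = 0) :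
    ∫ q in Set.univ ×ˢ Set.Ioi ε, fderiv ℝ f q (0, 1) = - ∫ x, f (x, ε) := by
  have hint := integrableOn_fderiv hε hf h0 (0, 1)
  rw [IntegrableOn, Measure.volume_eq_prod, ← Measure.prod_restrict, Measure.restrict_univ] at hint
  rw [Measure.volume_eq_prod, ← Measure.prod_restrict, Measure.restrict_univ,
    integral_prod _ hint, ← integral_neg]
  refine integral_congr_ae ?_
  filter_upwards [hint.prod_right_ae] with x hx
  have hd : ∀ y ∈ Set.Ici ε, HasDerivAt (fun y => f (x, y)) (fderiv ℝ f (x, y) (0, 1)) y :=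
    fun y hy => HasFDerivAt.comp_hasDerivAt (f := fun y => (x, y)) y
      (differentiableAt_upperHalf hf (q := (x, y)) (hε.trans_le hy)).hasFDerivAt
      ((hasDerivAt_const _ _).prodMk (hasDerivAt_id _))
  have ht : Tendsto (fun y => f (x, y)) atTop (𝓝 0) := by
    refine tendsto_const_nhds.congr' ?_
    filter_upwards [eventually_gt_atTop |R|, eventually_gt_atTop 0] with y hy hy0
    refine (h0 (x, y) hy0 ?_).symm
    refine lt_of_lt_of_le ?_ (sq_le_nsq_y x y)
    exact sq_lt_sq.2 (hy.trans_le (le_abs_self y))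
  rw [integral_Ioi_of_hasDerivAt_of_tendsto' hd hx ht, zero_sub]

end divergence

/-- Quantitative consequences of membership in the Signorini class which enter the first
variation formula. -/
structure Controlled (n : ℕ) (a : ℝ) (F U : Fn n) (R K : ℝ) : Prop where
  neg_one_lt : -1 < a
  lt_one : a < 1
  R_pos : 0 < R
  K_nonneg : 0 ≤ K
  smooth : ContDiffOn ℝ (⊤ : ℕ∞) (unc U) (openStrip n)
  pde : ∀ p ∈ openStrip n, unc (pdt U) p =
    unc (lapFull U) p + a / p.2.1 * unc (pdy U) p + unc F p
  abs_pdx_le : ∀ i, ∀ p ∈ openStrip n, |unc (pdx i U) p| ≤ K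
  abs_pdy_le : ∀ p ∈ openStrip n, |p.2.1 ^ a * unc (pdy U) p| ≤ K
  abs_pdt_le : ∀ p ∈ openStrip n, |unc (pdt U) p| ≤ K
  abs_F_le : ∀ p ∈ openStrip n, |unc F p| ≤ K
  pdx_eq_zero : ∀ i, ∀ p ∈ openStrip n, R ^ 2 ≤ nsq p.1 p.2.1 → unc (pdx i U) p = 0
  pdy_eq_zero : ∀ p ∈ openStrip n, R ^ 2 ≤ nsq p.1 p.2.1 → unc (pdy U) p = 0
  thin : ∀ s ∈ Set.Ioo (0 : ℝ) 1, ∀ s' ∈ Set.Ioo (0 : ℝ) 1, ∀ x : Fin n → ℝ, ∃ l ≤ (0 : ℝ),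
    Tendsto (fun y => (unc U (dil s' (x, y)) - unc U (dil s (x, y)))
      * (y ^ a * (s * unc (pdy U) (dil s (x, y))))) (𝓝[>] 0) (𝓝 l)

namespace SignoriniMem

variable {n : ℕ} {a : ℝ} {F U : Fn n}

lemma pdx_eq_zero {R : ℝ} (hR : ∀ x y t, R ^ 2 ≤ nsq x y → U x y t = 0) (i : Fin n)
    {x : Fin n → ℝ} {y t : ℝ} (h : R ^ 2 < nsq x y) : pdx i U x y t = 0 := by
  have hc : Continuous fun x' : Fin n → ℝ => nsq x' y :=
    continuous_nsq.comp (by fun_prop : Continuous fun x' : Fin n → ℝ => (x', y))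
  have : (fun x' => U x' y t) =ᶠ[𝓝 x] fun _ => 0 := by
    filter_upwards [(isOpen_lt continuous_const hc).mem_nhds h] with x' hx'
    exact hR x' y t (le_of_lt hx')
  rw [pdx, this.fderiv_eq]; simp

lemma pdy_eq_zero {R : ℝ} (hR : ∀ x y t, R ^ 2 ≤ nsq x y → U x y t = 0)
    {x : Fin n → ℝ} {y t : ℝ} (h : R ^ 2 < nsq x y) : pdy U x y t = 0 := by
  have hc : Continuous fun y' : ℝ => nsq x y' :=
    continuous_nsq.comp (by fun_prop : Continuous fun y' : ℝ => (x, y'))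
  have : (fun y' => U x y' t) =ᶠ[𝓝 y] fun _ => 0 := by
    filter_upwards [(isOpen_lt continuous_const hc).mem_nhds h] with y' hy'
    exact hR x y' t (le_of_lt hy')
  rw [pdy, this.deriv_eq]; simp

lemma neg_sq_mem {s : ℝ} (hs : s ∈ Set.Ioo (0 : ℝ) 1) : -s ^ 2 ∈ Set.Ioc (-1 : ℝ) 0 := by
  constructor <;> nlinarith [hs.1, hs.2]

lemma tendsto_dil_zero (hU : SignoriniMem n a F U) {s : ℝ} (hs : s ∈ Set.Ioo (0 : ℝ) 1)
    (x : Fin n → ℝ) :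
    Tendsto (fun y => unc U (dil s (x, y))) (𝓝[>] 0) (𝓝 (U (s • x) 0 (-s ^ 2))) := by
  have h1 := hU.cont (s • x, 0, -s ^ 2) ⟨le_rfl, neg_sq_mem hs⟩
  refine Tendsto.comp h1 (tendsto_nhdsWithin_iff.2 ⟨?_, ?_⟩)
  · have hc : Continuous fun y : ℝ => dil s (x, y) := by unfold dil; fun_prop
    have := hc.tendsto 0
    simp only [dil, mul_zero] at this
    exact this.mono_left nhdsWithin_le_nhds
  · filter_upwards [self_mem_nhdsWithin] with y hy
    exact ⟨(mul_pos hs.1 hy).le, neg_sq_mem hs⟩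

lemma thin_limit (hU : SignoriniMem n a F U) {s s' : ℝ} (hs : s ∈ Set.Ioo (0 : ℝ) 1)
    (hs' : s' ∈ Set.Ioo (0 : ℝ) 1) (x : Fin n → ℝ) : ∃ l ≤ (0 : ℝ),
    Tendsto (fun y => (unc U (dil s' (x, y)) - unc U (dil s (x, y)))
      * (y ^ a * (s * unc (pdy U) (dil s (x, y))))) (𝓝[>] 0) (𝓝 l) := by
  obtain ⟨L, hL, hlim, hzero⟩ := hU.signorini (s • x) (-s ^ 2) (neg_sq_mem hs)
  have hsc : Tendsto (fun y : ℝ => s * y) (𝓝[>] 0) (𝓝[>] 0) := by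
    refine tendsto_nhdsWithin_iff.2 ⟨?_, ?_⟩
    · have := (continuous_const_mul s).tendsto 0
      rw [mul_zero] at this
      exact this.mono_left nhdsWithin_le_nhds
    · filter_upwards [self_mem_nhdsWithin] with y hy using mul_pos hs.1 hy
  have h2 : Tendsto (fun y => y ^ a * (s * unc (pdy U) (dil s (x, y)))) (𝓝[>] 0)
      (𝓝 (s * (s ^ a)⁻¹ * L)) := by
    refine ((hlim.comp hsc).const_mul (s * (s ^ a)⁻¹)).congr' ?_
    filter_upwards [self_mem_nhdsWithin] with y hy
    have hsa : s ^ a ≠ 0 := (Real.rpow_pos_of_pos hs.1 a).ne'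
    simp only [Function.comp, unc, dil]
    rw [Real.mul_rpow hs.1.le (le_of_lt hy)]
    field_simp
  refine ⟨_, ?_, ((hU.tendsto_dil_zero hs' x).sub (hU.tendsto_dil_zero hs x)).mul h2⟩
  have hpos : 0 ≤ s * (s ^ a)⁻¹ := mul_nonneg hs.1.le (inv_nonneg.2 (Real.rpow_nonneg hs.1.le a))
  have h3 := hU.nonneg (s' • x) (-s' ^ 2) (neg_sq_mem hs')
  have h4 : U (s' • x) 0 (-s' ^ 2) * L ≤ 0 := mul_nonpos_of_nonneg_of_nonpos h3 hL
  have : (U (s' • x) 0 (-s' ^ 2) - U (s • x) 0 (-s ^ 2)) * (s * (s ^ a)⁻¹ * L)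
      = (s * (s ^ a)⁻¹) * (U (s' • x) 0 (-s' ^ 2) * L) := by
    linear_combination (-(s * (s ^ a)⁻¹)) * hzero
  rw [this]
  exact mul_nonpos_of_nonneg_of_nonpos hpos h4

/-- Members of the Signorini class with bounded right-hand side are controlled. -/
lemma controlled (hU : SignoriniMem n a F U) (ha₁ : -1 < a) (ha₂ : a < 1)
    (hF : ∃ M : ℝ, ∀ x y t, 0 < y → t ∈ Set.Ioc (-1 : ℝ) 0 → |F x y t| ≤ M) :
    ∃ R K, Controlled n a F U R K := by
  obtain ⟨R₀, hR₀, hsupp⟩ := hU.bddSupp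
  obtain ⟨α, hα, Cx, hCx⟩ := hU.holderX
  obtain ⟨β, hβ, Cy, hCy⟩ := hU.holderY
  obtain ⟨Mt, hMt⟩ := hU.bddTime
  obtain ⟨MF, hMF⟩ := hF
  set R := R₀ + 1
  have hR : R₀ ^ 2 < R ^ 2 := by simp only [R]; nlinarith
  have hmem : ∀ p ∈ openStrip n, 0 < p.2.1 ∧ p.2.2 ∈ Set.Ioc (-1 : ℝ) 0 :=
    fun p hp => ⟨hp.1, hp.2.1, hp.2.2.le⟩
  have hfar : ∀ (x : Fin n → ℝ) {y : ℝ}, 0 < y → R₀ ^ 2 < nsq x (y + R) := fun x y hy => by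
    refine lt_of_lt_of_le ?_ (sq_le_nsq_y x (y + R))
    simp only [R]; nlinarith
  set K := |Cx * (R ^ 2) ^ (α / 2)| + |Cy * (R ^ 2) ^ (β / 2)| + |Mt| + |MF|
  have hKx : |Cx * (R ^ 2) ^ (α / 2)| ≤ K := by
    simp only [K]; linarith [abs_nonneg (Cy * (R ^ 2) ^ (β / 2)), abs_nonneg Mt, abs_nonneg MF]
  have hKy : |Cy * (R ^ 2) ^ (β / 2)| ≤ K := by
    simp only [K]; linarith [abs_nonneg (Cx * (R ^ 2) ^ (α / 2)), abs_nonneg Mt, abs_nonneg MF]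
  have hKt : |Mt| ≤ K := by
    simp only [K]; linarith [abs_nonneg (Cx * (R ^ 2) ^ (α / 2)),
      abs_nonneg (Cy * (R ^ 2) ^ (β / 2)), abs_nonneg MF]
  have hKF : |MF| ≤ K := by
    simp only [K]; linarith [abs_nonneg (Cx * (R ^ 2) ^ (α / 2)),
      abs_nonneg (Cy * (R ^ 2) ^ (β / 2)), abs_nonneg Mt]
  refine ⟨R, K, ha₁, ha₂, by positivity, (abs_nonneg _).trans hKF, ?_, ?_, ?_, ?_, ?_, ?_, ?_,
    ?_, fun s hs s' hs' x => hU.thin_limit hs hs' x⟩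
  · intro p hp
    exact (hU.smooth p.1 p.2.1 p.2.2 (hmem p hp).1 (hmem p hp).2).contDiffWithinAt
  · exact fun p hp => hU.pde p.1 p.2.1 p.2.2 (hmem p hp).1 (hmem p hp).2
  · intro i p hp
    obtain ⟨h1, h2⟩ := hmem p hp
    have := hCx i p.1 p.2.1 p.2.2 p.1 (p.2.1 + R) p.2.2 h1 (by positivity) h2 h2
    rw [pdx_eq_zero hsupp i (hfar p.1 h1)] at this
    refine le_trans ?_ ((le_abs_self _).trans hKx)
    simpa [unc] using this
  · intro p hp
    obtain ⟨h1, h2⟩ := hmem p hp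
    have := hCy p.1 p.2.1 p.2.2 p.1 (p.2.1 + R) p.2.2 h1 (by positivity) h2 h2
    rw [pdy_eq_zero hsupp (hfar p.1 h1)] at this
    refine le_trans ?_ ((le_abs_self _).trans hKy)
    simpa [unc] using this
  · exact fun p hp => (hMt _ _ _ (hmem p hp).1 (hmem p hp).2).trans ((le_abs_self _).trans hKt)
  · exact fun p hp => (hMF _ _ _ (hmem p hp).1 (hmem p hp).2).trans ((le_abs_self _).trans hKF)
  · exact fun i p _ h => pdx_eq_zero hsupp i (hR.trans_le h)
  · exact fun p _ h => pdy_eq_zero hsupp (hR.trans_le h)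

end SignoriniMem

namespace Controlled

variable {n : ℕ} {a : ℝ} {F U : Fn n} {R K : ℝ}

/-- A bound for `|ZU|`. -/
def zbound (n : ℕ) (a R K : ℝ) : ℝ := n * (R * K) + R ^ (1 - a) * K + 2 * K

lemma zbound_nonneg (h : Controlled n a F U R K) : 0 ≤ zbound n a R K := by
  have := h.R_pos; have := h.K_nonneg
  unfold zbound; positivity

lemma abs_Zop_le (h : Controlled n a F U R K) {p : Pt n} (hp : p ∈ openStrip n) :
    |unc (Zop U) p| ≤ zbound n a R K := by
  have hR := h.R_pos
  have hK := h.K_nonneg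
  have hy : 0 < p.2.1 := hp.1
  have hx : ∀ i, |p.1 i * unc (pdx i U) p| ≤ R * K := fun i => by
    rcases le_or_gt (R ^ 2) (nsq p.1 p.2.1) with hc | hc
    · rw [h.pdx_eq_zero i p hp hc]; simp; positivity
    · rw [abs_mul]
      refine mul_le_mul ?_ (h.abs_pdx_le i p hp) (abs_nonneg _) hR.le
      exact abs_le_of_sq_le_sq ((sq_le_nsq_x p.1 p.2.1 i).trans hc.le) hR.le
  have hyy : |p.2.1 * unc (pdy U) p| ≤ R ^ (1 - a) * K := by
    rcases le_or_gt (R ^ 2) (nsq p.1 p.2.1) with hc | hc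
    · rw [h.pdy_eq_zero p hp hc]; simp; positivity
    · have hyR : p.2.1 ≤ R :=
        (le_abs_self _).trans (abs_le_of_sq_le_sq ((sq_le_nsq_y p.1 p.2.1).trans hc.le) hR.le)
      have : p.2.1 * unc (pdy U) p = p.2.1 ^ (1 - a) * (p.2.1 ^ a * unc (pdy U) p) := by
        rw [← mul_assoc, ← Real.rpow_add hy]; simp
      rw [this, abs_mul, abs_of_nonneg (Real.rpow_nonneg hy.le _)]
      exact mul_le_mul (Real.rpow_le_rpow hy.le hyR (by linarith [h.lt_one])) (h.abs_pdy_le p hp)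
        (abs_nonneg _) (by positivity)
  have htt : |2 * p.2.2 * unc (pdt U) p| ≤ 2 * K := by
    rw [abs_mul]
    refine mul_le_mul ?_ (h.abs_pdt_le p hp) (abs_nonneg _) (by norm_num)
    rw [abs_le]
    constructor <;> linarith [hp.2.1, hp.2.2]
  have hsum : |∑ i, p.1 i * unc (pdx i U) p| ≤ n * (R * K) := by
    refine (Finset.abs_sum_le_sum_abs _ _).trans ((Finset.sum_le_sum fun i _ => hx i).trans ?_)
    simp
  exact (abs_add_le _ _).trans (add_le_add ((abs_add_le _ _).trans (add_le_add hsum hyy)) htt)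

lemma contDiffOn_lapFull (h : ContDiffOn ℝ (⊤ : ℕ∞) (unc U) (openStrip n)) :
    ContDiffOn ℝ (⊤ : ℕ∞) (unc (lapFull U)) (openStrip n) :=
  (ContDiffOn.sum fun i _ => contDiffOn_pdx i (contDiffOn_pdx i h)).add
    (contDiffOn_pdy (contDiffOn_pdy h))

lemma continuousOn_F (h : Controlled n a F U R K) : ContinuousOn (unc F) (openStrip n) := by
  have : ContinuousOn (fun p => unc (pdt U) p - unc (lapFull U) p - a / p.2.1 * unc (pdy U) p)
      (openStrip n) := by
    refine ((contDiffOn_pdt h.smooth).continuousOn.sub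
      (contDiffOn_lapFull h.smooth).continuousOn).sub
      (ContinuousOn.mul ?_ (contDiffOn_pdy h.smooth).continuousOn)
    exact continuousOn_const.div (by fun_prop) fun p hp => hp.1.ne'
  refine this.congr fun p hp => ?_
  have := h.pde p hp
  simp only
  linarith

/-- The Ornstein–Uhlenbeck operator applied to the rescaling of `U`, as given by the equation. -/
def drift (F U : Fn n) (s : ℝ) (q : (Fin n → ℝ) × ℝ) : ℝ :=
  -(1 / 2) * unc (Zop U) (dil s q) - s ^ 2 * unc F (dil s q)

lemma abs_drift_le (h : Controlled n a F U R K) {s : ℝ} (hs : s ∈ Set.Ioo (0 : ℝ) 1)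
    {q : (Fin n → ℝ) × ℝ} (hq : q ∈ upperHalf n) :
    |drift F U s q| ≤ zbound n a R K + K := by
  have h1 := abs_le.1 (h.abs_Zop_le (dil_mem hs hq))
  have h2 := abs_le.1 (h.abs_F_le _ (dil_mem hs hq))
  have h3 := h.zbound_nonneg
  have h4 : s ^ 2 ≤ 1 := by nlinarith [hs.1, hs.2]
  have h5 : |s ^ 2 * unc F (dil s q)| ≤ K := by
    rw [abs_mul, abs_of_nonneg (sq_nonneg s)]
    nlinarith [h.abs_F_le _ (dil_mem hs hq), abs_nonneg (unc F (dil s q))]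
  have h6 := abs_le.1 h5
  unfold drift
  rw [abs_le]
  constructor <;> linarith [h1.1, h1.2, h6.1, h6.2]

lemma continuousOn_comp_dil {G : Pt n → ℝ} (hG : ContinuousOn G (openStrip n)) {s : ℝ}
    (hs : s ∈ Set.Ioo (0 : ℝ) 1) : ContinuousOn (fun q => G (dil s q)) (upperHalf n) := by
  refine hG.comp (Continuous.continuousOn ?_) fun q hq => dil_mem hs hq
  unfold dil; fun_prop

lemma continuousAt_dil_s {G : Pt n → ℝ} (hG : ContinuousOn G (openStrip n)) {s : ℝ}
    (hs : s ∈ Set.Ioo (0 : ℝ) 1) {q : (Fin n → ℝ) × ℝ} (hq : q ∈ upperHalf n) :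
    ContinuousAt (fun s => G (dil s q)) s := by
  have h1 : ContinuousAt G (dil s q) :=
    hG.continuousAt ((isOpen_openStrip n).mem_nhds (dil_mem hs hq))
  have h2 : Continuous fun s : ℝ => dil s q := by unfold dil; fun_prop
  exact ContinuousAt.comp (f := fun s : ℝ => dil s q) h1 h2.continuousAt

lemma continuousOn_drift (h : Controlled n a F U R K) {s : ℝ} (hs : s ∈ Set.Ioo (0 : ℝ) 1) :
    ContinuousOn (drift F U s) (upperHalf n) :=
  (continuousOn_const.mul (continuousOn_comp_dil (contDiffOn_Zop h.smooth).continuousOn hs)).sub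
    (continuousOn_const.mul (continuousOn_comp_dil h.continuousOn_F hs))

lemma tendsto_drift (h : Controlled n a F U R K) {s : ℝ} (hs : s ∈ Set.Ioo (0 : ℝ) 1)
    {q : (Fin n → ℝ) × ℝ} (hq : q ∈ upperHalf n) :
    ContinuousAt (fun s => drift F U s q) s :=
  (continuousAt_const.mul (continuousAt_dil_s (contDiffOn_Zop h.smooth).continuousOn hs hq)).sub
    ((continuousAt_id.pow 2).mul (continuousAt_dil_s h.continuousOn_F hs hq))

/-- The increment of the rescalings of `U` between `s` and `s'`. -/
def incr (U : Fn n) (s s' : ℝ) (q : (Fin n → ℝ) × ℝ) : ℝ :=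
  unc U (dil s' q) - unc U (dil s q)

lemma abs_incr_le (h : Controlled n a F U R K) {m s s' : ℝ} (hm : 0 < m)
    (hs : s ∈ Set.Ico m 1) (hs' : s' ∈ Set.Ico m 1) {q : (Fin n → ℝ) × ℝ}
    (hq : q ∈ upperHalf n) : |incr U s s' q| ≤ m⁻¹ * zbound n a R K * |s' - s| := by
  have hpos : ∀ σ ∈ Set.Ico m 1, σ ∈ Set.Ioo (0 : ℝ) 1 := fun σ hσ => ⟨hm.trans_le hσ.1, hσ.2⟩
  refine (convex_Ico m 1).norm_image_sub_le_of_norm_hasDerivWithin_le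
    (f := fun σ => unc U (dil σ q)) (f' := fun σ => σ⁻¹ * unc (Zop U) (dil σ q))
    (fun σ hσ => (hasDerivAt_dil_s (hpos σ hσ).1.ne'
      (differentiableAt_of_smooth h.smooth (dil_mem (hpos σ hσ) hq))).hasDerivWithinAt)
    (fun σ hσ => ?_) hs hs'
  rw [Real.norm_eq_abs, abs_mul, abs_of_pos (inv_pos.2 (hpos σ hσ).1)]
  exact mul_le_mul (inv_anti₀ hm hσ.1) (h.abs_Zop_le (dil_mem (hpos σ hσ) hq)) (abs_nonneg _)
    (inv_nonneg.2 hm.le)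

lemma contDiffOn_incr (h : Controlled n a F U R K) {s s' : ℝ} (hs : s ∈ Set.Ioo (0 : ℝ) 1)
    (hs' : s' ∈ Set.Ioo (0 : ℝ) 1) : ContDiffOn ℝ (⊤ : ℕ∞) (incr U s s') (upperHalf n) :=
  (contDiffOn_dil h.smooth hs').sub (contDiffOn_dil h.smooth hs)

/-- The product `⟨∇V_s, ∇(V_{s'} − V_s)⟩` for the rescalings `V_s` of `U`. -/
def cross (U : Fn n) (s s' : ℝ) (q : (Fin n → ℝ) × ℝ) : ℝ :=
  (∑ i, (s' * unc (pdx i U) (dil s' q) - s * unc (pdx i U) (dil s q))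
      * (s * unc (pdx i U) (dil s q)))
    + (s' * unc (pdy U) (dil s' q) - s * unc (pdy U) (dil s q)) * (s * unc (pdy U) (dil s q))

/-- The flux `(V_{s'} − V_s) γ G`, for a component `s G` of the gradient of `V_s`. -/
def flux (a : ℝ) (U G : Fn n) (s s' : ℝ) (q : (Fin n → ℝ) × ℝ) : ℝ :=
  incr U s s' q * (gam n a q * (s * unc G (dil s q)))

lemma contDiffOn_flux (h : Controlled n a F U R K) {G : Fn n}
    (hG : ContDiffOn ℝ (⊤ : ℕ∞) (unc G) (openStrip n)) {s s' : ℝ} (hs : s ∈ Set.Ioo (0 : ℝ) 1)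
    (hs' : s' ∈ Set.Ioo (0 : ℝ) 1) : ContDiffOn ℝ (⊤ : ℕ∞) (flux a U G s s') (upperHalf n) :=
  (h.contDiffOn_incr hs hs').mul (contDiffOn_gam.mul (contDiffOn_const.mul (contDiffOn_dil hG hs)))

lemma fderiv_flux (h : Controlled n a F U R K) {G : Fn n}
    (hG : ContDiffOn ℝ (⊤ : ℕ∞) (unc G) (openStrip n)) {s s' : ℝ} (hs : s ∈ Set.Ioo (0 : ℝ) 1)
    (hs' : s' ∈ Set.Ioo (0 : ℝ) 1) {q : (Fin n → ℝ) × ℝ} (hq : q ∈ upperHalf n)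
    (v : (Fin n → ℝ) × ℝ) :
    fderiv ℝ (flux a U G s s') q v =
      (fderiv ℝ (fun q => unc U (dil s' q)) q v - fderiv ℝ (fun q => unc U (dil s q)) q v)
          * (gam n a q * (s * unc G (dil s q)))
        + incr U s s' q * (fderiv ℝ (gam n a) q v * (s * unc G (dil s q))
          + gam n a q * (s * fderiv ℝ (fun q => unc G (dil s q)) q v)) := by
  have d1 := (differentiableAt_upperHalf (contDiffOn_dil h.smooth hs') hq).hasFDerivAt
  have d2 := (differentiableAt_upperHalf (contDiffOn_dil h.smooth hs) hq).hasFDerivAt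
  have d3 := (differentiableAt_upperHalf (contDiffOn_gam (n := n) (a := a)) hq).hasFDerivAt
  have d4 := (differentiableAt_upperHalf (contDiffOn_dil hG hs) hq).hasFDerivAt
  have hd : HasFDerivAt (flux a U G s s') _ q :=
    (d1.fun_sub d2).fun_mul (d3.fun_mul (d4.const_mul s))
  rw [hd.fderiv]
  simp [incr]
  ring

lemma div_flux (h : Controlled n a F U R K) {s s' : ℝ} (hs : s ∈ Set.Ioo (0 : ℝ) 1)
    (hs' : s' ∈ Set.Ioo (0 : ℝ) 1) {q : (Fin n → ℝ) × ℝ} (hq : q ∈ upperHalf n) :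
    (∑ i, fderiv ℝ (flux a U (pdx i U) s s') q (Pi.single i 1, 0))
        + fderiv ℝ (flux a U (pdy U) s s') q (0, 1)
      = cross U s s' q * gam n a q + incr U s s' q * drift F U s q * gam n a q := by
  have hm := dil_mem hs hq
  have hm' := dil_mem hs' hq
  have hy : q.2 ≠ 0 := ne_of_gt hq
  have hs0 : s ≠ 0 := hs.1.ne'
  have dU := differentiableAt_of_smooth h.smooth hm
  have dU' := differentiableAt_of_smooth h.smooth hm'
  have hpx := fun i => contDiffOn_pdx i h.smooth
  have hpy := contDiffOn_pdy h.smooth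
  rw [h.fderiv_flux hpy hs hs' hq, fderiv_dil_y dU, fderiv_dil_y dU', fderiv_gam hq,
    fderiv_dil_y (differentiableAt_of_smooth hpy hm)]
  simp_rw [fun i => h.fderiv_flux (hpx i) hs hs' hq (Pi.single i 1, 0), fun i => fderiv_dil_x i dU,
    fun i => fderiv_dil_x i dU', fderiv_gam hq,
    fun i => fderiv_dil_x i (differentiableAt_of_smooth (hpx i) hm)]
  have hpde := h.pde _ hm
  have hlap : unc (lapFull U) (dil s q)
      = (∑ i, unc (pdx i (pdx i U)) (dil s q)) + unc (pdy (pdy U)) (dil s q) := rfl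
  have hZ : unc (Zop U) (dil s q) = (∑ i, s * q.1 i * unc (pdx i U) (dil s q))
      + s * q.2 * unc (pdy U) (dil s q) + 2 * (-s ^ 2) * unc (pdt U) (dil s q) := rfl
  have hsum : ∑ i, ((s' * unc (pdx i U) (dil s' q) - s * unc (pdx i U) (dil s q))
        * (gam n a q * (s * unc (pdx i U) (dil s q)))
      + incr U s s' q * ((-(∑ j, q.1 j * (Pi.single i 1 : Fin n → ℝ) j) / 2
            + (a / q.2 - q.2 / 2) * 0) * gam n a q * (s * unc (pdx i U) (dil s q))
          + gam n a q * (s * (s * unc (pdx i (pdx i U)) (dil s q)))))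
      = (∑ i, (s' * unc (pdx i U) (dil s' q) - s * unc (pdx i U) (dil s q))
          * (s * unc (pdx i U) (dil s q))) * gam n a q
        + incr U s s' q * gam n a q * (s ^ 2 * (∑ i, unc (pdx i (pdx i U)) (dil s q))
          - 1 / 2 * ∑ i, s * q.1 i * unc (pdx i U) (dil s q)) := by
    rw [Finset.mul_sum, Finset.mul_sum, ← Finset.sum_sub_distrib, Finset.mul_sum, Finset.sum_mul,
      ← Finset.sum_add_distrib]
    refine Finset.sum_congr rfl fun i _ => ?_
    have : ∑ j, q.1 j * (Pi.single i 1 : Fin n → ℝ) j = q.1 i := by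
      simp [Pi.single_apply]
    rw [this]; ring
  rw [hsum]
  simp only [Pi.zero_apply, mul_zero, Finset.sum_const_zero, cross, drift]
  rw [hZ]
  have hF : unc F (dil s q) = unc (pdt U) (dil s q) - ((∑ i, unc (pdx i (pdx i U)) (dil s q))
      + unc (pdy (pdy U)) (dil s q)) - a / (s * q.2) * unc (pdy U) (dil s q) := by
    rw [hpde, hlap]
    simp only [dil]
    ring
  rw [hF]
  field_simp
  ring

end Controlled

lemma integrableOn_mul_gam {n : ℕ} {a C : ℝ} (ha₁ : -1 < a) (ha₂ : a < 1)
    {f : (Fin n → ℝ) × ℝ → ℝ} (hf : ContinuousOn f (upperHalf n))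
    (hb : ∀ q ∈ upperHalf n, |f q| ≤ C * (1 + q.2 ^ (-(2 * a)))) :
    IntegrableOn (fun q => f q * gam n a q) (upperHalf n) := by
  have hm := (isOpen_upperHalf n).measurableSet
  refine Integrable.mono' ((integrableOn_dom ha₁ ha₂).const_mul C)
    ((hf.mul contDiffOn_gam.continuousOn).aestronglyMeasurable hm)
    (ae_restrict_of_forall_mem hm fun q hq => ?_)
  have h0 := gam_nonneg ha₁ hq
  rw [Real.norm_eq_abs, abs_mul, abs_of_nonneg h0, dom, ← mul_assoc]
  exact mul_le_mul_of_nonneg_right (hb q hq) h0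

lemma one_le_one_add_rpow {n : ℕ} {q : (Fin n → ℝ) × ℝ} (hq : q ∈ upperHalf n) (b : ℝ) :
    1 ≤ 1 + q.2 ^ b := by
  linarith [Real.rpow_nonneg (le_of_lt (show 0 < q.2 from hq)) b]

lemma tendsto_setIntegral_upperHalf {n : ℕ} {f : (Fin n → ℝ) × ℝ → ℝ}
    (hf : IntegrableOn f (upperHalf n)) :
    Tendsto (fun ε => ∫ q in Set.univ ×ˢ Set.Ioi ε, f q) (𝓝[>] 0)
      (𝓝 (∫ q in upperHalf n, f q)) := by
  have hm : ∀ ε : ℝ, MeasurableSet (Set.univ ×ˢ Set.Ioi ε : Set ((Fin n → ℝ) × ℝ)) := fun ε =>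
    MeasurableSet.univ.prod measurableSet_Ioi
  have hsub : ∀ ε : ℝ, 0 < ε → (Set.univ ×ˢ Set.Ioi ε : Set ((Fin n → ℝ) × ℝ)) ⊆ upperHalf n :=
    fun ε hε q hq => hε.trans hq.2
  simp_rw [← integral_indicator (hm _), ← integral_indicator (isOpen_upperHalf n).measurableSet]
  refine tendsto_integral_filter_of_dominated_convergence
    (fun q => ‖(upperHalf n).indicator f q‖) ?_ ?_ ?_ ?_
  · filter_upwards [self_mem_nhdsWithin] with ε hε
    exact ((hf.mono_set (hsub ε hε)).integrable_indicator (hm ε)).aestronglyMeasurable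
  · filter_upwards [self_mem_nhdsWithin] with ε hε
    exact Eventually.of_forall fun q => norm_indicator_le_of_subset (hsub ε hε) f q
  · exact (hf.integrable_indicator (isOpen_upperHalf n).measurableSet).norm
  · refine Eventually.of_forall fun q => tendsto_const_nhds.congr' ?_
    by_cases hq : q ∈ upperHalf n
    · filter_upwards [Ioo_mem_nhdsGT (show 0 < q.2 from hq)] with ε hε
      have hq' : q ∈ (Set.univ ×ˢ Set.Ioi ε : Set ((Fin n → ℝ) × ℝ)) := ⟨Set.mem_univ _, hε.2⟩
      rw [Set.indicator_of_mem hq, Set.indicator_of_mem hq']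
    · filter_upwards [self_mem_nhdsWithin] with ε hε
      rw [Set.indicator_of_notMem hq, Set.indicator_of_notMem fun h => hq (hsub ε hε h)]

namespace Controlled

variable {n : ℕ} {a : ℝ} {F U : Fn n} {R K : ℝ}

lemma abs_smul_pdx_le (h : Controlled n a F U R K) (i : Fin n) {s : ℝ}
    (hs : s ∈ Set.Ioo (0 : ℝ) 1) {q : (Fin n → ℝ) × ℝ} (hq : q ∈ upperHalf n) :
    |s * unc (pdx i U) (dil s q)| ≤ K := by
  rw [abs_mul, abs_of_pos hs.1]
  nlinarith [h.abs_pdx_le i _ (dil_mem hs hq), abs_nonneg (unc (pdx i U) (dil s q)), hs.1, hs.2]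

lemma abs_rpow_mul_smul_pdy_le (h : Controlled n a F U R K) {s : ℝ}
    (hs : s ∈ Set.Ioo (0 : ℝ) 1) {q : (Fin n → ℝ) × ℝ} (hq : q ∈ upperHalf n) :
    |q.2 ^ a * (s * unc (pdy U) (dil s q))| ≤ K := by
  have hy : 0 < q.2 := hq
  have h1 : q.2 ^ a * (s * unc (pdy U) (dil s q))
      = s ^ (1 - a) * ((s * q.2) ^ a * unc (pdy U) (dil s q)) := by
    rw [Real.mul_rpow hs.1.le hy.le, Real.rpow_sub hs.1, Real.rpow_one]
    have := (Real.rpow_pos_of_pos hs.1 a).ne'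
    field_simp
  have h2 : |(s * q.2) ^ a * unc (pdy U) (dil s q)| ≤ K := h.abs_pdy_le _ (dil_mem hs hq)
  have h3 : s ^ (1 - a) ≤ 1 := Real.rpow_le_one hs.1.le hs.2.le (by linarith [h.lt_one])
  rw [h1, abs_mul, abs_of_nonneg (Real.rpow_nonneg hs.1.le _)]
  exact (mul_le_of_le_one_left (abs_nonneg _) h3).trans h2

lemma abs_smul_pdy_le (h : Controlled n a F U R K) {s : ℝ}
    (hs : s ∈ Set.Ioo (0 : ℝ) 1) {q : (Fin n → ℝ) × ℝ} (hq : q ∈ upperHalf n) :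
    |s * unc (pdy U) (dil s q)| ≤ K * q.2 ^ (-a) := by
  have hy : 0 < q.2 := hq
  have h1 := h.abs_rpow_mul_smul_pdy_le hs hq
  have h2 := Real.rpow_pos_of_pos hy a
  rw [abs_mul, abs_of_pos h2] at h1
  rw [Real.rpow_neg hy.le, ← div_eq_mul_inv, le_div_iff₀ h2]
  linarith

lemma abs_cross_le (h : Controlled n a F U R K) {s s' : ℝ} (hs : s ∈ Set.Ioo (0 : ℝ) 1)
    (hs' : s' ∈ Set.Ioo (0 : ℝ) 1) {q : (Fin n → ℝ) × ℝ} (hq : q ∈ upperHalf n) :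
    |cross U s s' q| ≤ (2 * (n + 1) * K ^ 2) * (1 + q.2 ^ (-(2 * a))) := by
  have hy : 0 < q.2 := hq
  have key : ∀ {b c B : ℝ}, |b| ≤ B → |c| ≤ B → |(b - c) * c| ≤ 2 * B ^ 2 := fun {b c B} hb hc => by
    have hB := (abs_nonneg b).trans hb
    rw [abs_mul, pow_two, ← mul_assoc]
    exact mul_le_mul ((abs_sub b c).trans (by linarith)) hc (abs_nonneg _) (by linarith)
  have h1 : |∑ i, (s' * unc (pdx i U) (dil s' q) - s * unc (pdx i U) (dil s q))
      * (s * unc (pdx i U) (dil s q))| ≤ n * (2 * K ^ 2) := by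
    refine (Finset.abs_sum_le_sum_abs _ _).trans ((Finset.sum_le_sum fun i _ =>
      key (h.abs_smul_pdx_le i hs' hq) (h.abs_smul_pdx_le i hs hq)).trans ?_)
    simp
  have h2 := key (h.abs_smul_pdy_le hs' hq) (h.abs_smul_pdy_le hs hq)
  have h3 : (q.2 ^ (-a)) ^ 2 = q.2 ^ (-(2 * a)) := by
    rw [← Real.rpow_natCast, ← Real.rpow_mul hy.le]; congr 1; push_cast; ring
  rw [mul_pow, h3] at h2
  have h4 := Real.rpow_nonneg hy.le (-(2 * a))
  refine (abs_add_le _ _).trans ((add_le_add h1 h2).trans ?_)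
  have : 0 ≤ n * K ^ 2 * q.2 ^ (-(2 * a)) := by positivity
  nlinarith [sq_nonneg K]

lemma continuousOn_cross (h : Controlled n a F U R K) {s s' : ℝ} (hs : s ∈ Set.Ioo (0 : ℝ) 1)
    (hs' : s' ∈ Set.Ioo (0 : ℝ) 1) : ContinuousOn (cross U s s') (upperHalf n) := by
  have hx := fun i => (contDiffOn_pdx i h.smooth).continuousOn
  have hy := (contDiffOn_pdy h.smooth).continuousOn
  refine ContinuousOn.add (continuousOn_finsetSum _ fun i _ => ?_) ?_
  · exact ((continuousOn_const.mul (continuousOn_comp_dil (hx i) hs')).sub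
      (continuousOn_const.mul (continuousOn_comp_dil (hx i) hs))).mul
      (continuousOn_const.mul (continuousOn_comp_dil (hx i) hs))
  · exact ((continuousOn_const.mul (continuousOn_comp_dil hy hs')).sub
      (continuousOn_const.mul (continuousOn_comp_dil hy hs))).mul
      (continuousOn_const.mul (continuousOn_comp_dil hy hs))

lemma integrableOn_cross (h : Controlled n a F U R K) {s s' : ℝ} (hs : s ∈ Set.Ioo (0 : ℝ) 1)
    (hs' : s' ∈ Set.Ioo (0 : ℝ) 1) :
    IntegrableOn (fun q => cross U s s' q * gam n a q) (upperHalf n) :=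
  integrableOn_mul_gam h.neg_one_lt h.lt_one (h.continuousOn_cross hs hs')
    fun _ hq => h.abs_cross_le hs hs' hq

lemma integrableOn_incr_mul_drift (h : Controlled n a F U R K) {s s' : ℝ}
    (hs : s ∈ Set.Ioo (0 : ℝ) 1) (hs' : s' ∈ Set.Ioo (0 : ℝ) 1) :
    IntegrableOn (fun q => incr U s s' q * drift F U s q * gam n a q) (upperHalf n) := by
  have hm : 0 < min s s' := lt_min hs.1 hs'.1
  have hz := h.zbound_nonneg
  have hK := h.K_nonneg
  refine integrableOn_mul_gam (C := ((min s s')⁻¹ * zbound n a R K * |s' - s|)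
    * (zbound n a R K + K)) h.neg_one_lt h.lt_one
    ((h.contDiffOn_incr hs hs').continuousOn.mul (h.continuousOn_drift hs)) fun q hq => ?_
  rw [abs_mul]
  refine (mul_le_mul (h.abs_incr_le hm ⟨min_le_left _ _, hs.2⟩ ⟨min_le_right _ _, hs'.2⟩ hq)
    (h.abs_drift_le hs hq) (abs_nonneg _) (by positivity)).trans ?_
  exact le_mul_of_one_le_right (by positivity) (one_le_one_add_rpow hq _)

lemma flux_eq_zero {G : Fn n} (hG : ∀ p ∈ openStrip n, R ^ 2 ≤ nsq p.1 p.2.1 → unc G p = 0)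
    {s s' : ℝ} (hs : s ∈ Set.Ioo (0 : ℝ) 1) {q : (Fin n → ℝ) × ℝ} (hq : q ∈ upperHalf n)
    (hR : (R / s) ^ 2 < nsq q.1 q.2) : flux a U G s s' q = 0 := by
  have : unc G (dil s q) = 0 := by
    refine hG _ (dil_mem hs hq) ?_
    simp only [dil, nsq_smul]
    rw [div_pow, div_lt_iff₀ (by have := hs.1; positivity)] at hR
    linarith
  rw [flux, this]; ring

lemma setIntegral_div_flux (h : Controlled n a F U R K) {s s' ε : ℝ}
    (hs : s ∈ Set.Ioo (0 : ℝ) 1) (hs' : s' ∈ Set.Ioo (0 : ℝ) 1) (hε : 0 < ε) :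
    ∫ q in Set.univ ×ˢ Set.Ioi ε,
        (cross U s s' q * gam n a q + incr U s s' q * drift F U s q * gam n a q)
      = - ∫ x, flux a U (pdy U) s s' (x, ε) := by
  have hx := fun i => h.contDiffOn_flux (contDiffOn_pdx i h.smooth) hs hs'
  have hy := h.contDiffOn_flux (contDiffOn_pdy h.smooth) hs hs'
  have hx0 : ∀ i, ∀ q ∈ upperHalf n, (R / s) ^ 2 < nsq q.1 q.2 →
    flux a U (pdx i U) s s' q = 0 := fun i q hq hR => flux_eq_zero (h.pdx_eq_zero i) hs hq hR
  have hy0 : ∀ q ∈ upperHalf n, (R / s) ^ 2 < nsq q.1 q.2 →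
    flux a U (pdy U) s s' q = 0 := fun q hq hR => flux_eq_zero h.pdy_eq_zero hs hq hR
  have hdiv : ∀ q ∈ (Set.univ ×ˢ Set.Ioi ε : Set ((Fin n → ℝ) × ℝ)), _ = _ := fun q hq =>
    h.div_flux hs hs' (q := q) (hε.trans hq.2)
  rw [← setIntegral_congr_fun (MeasurableSet.univ.prod measurableSet_Ioi) hdiv, integral_add
    (integrable_finsetSum _ fun i _ => integrableOn_fderiv hε (hx i) (hx0 i) _)
    (integrableOn_fderiv hε hy hy0 _), integral_finsetSum _
    fun i _ => integrableOn_fderiv hε (hx i) (hx0 i) _, integral_fderiv_y hε hy hy0]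
  simp [integral_fderiv_x hε (hx _) (hx0 _)]

/-- The weak formulation of the Signorini problem, tested with a competitor. -/
lemma variational_inequality (h : Controlled n a F U R K) {s s' : ℝ}
    (hs : s ∈ Set.Ioo (0 : ℝ) 1) (hs' : s' ∈ Set.Ioo (0 : ℝ) 1) :
    0 ≤ (∫ q in upperHalf n, cross U s s' q * gam n a q)
      + ∫ q in upperHalf n, incr U s s' q * drift F U s q * gam n a q := by
  have hi1 := h.integrableOn_cross hs hs'
  have hi2 := h.integrableOn_incr_mul_drift hs hs'
  have hg := gcst_nonneg n h.neg_one_lt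
  have hm : 0 < min s s' := lt_min hs.1 hs'.1
  have hz := h.zbound_nonneg
  have hK := h.K_nonneg
  rw [← integral_add hi1 hi2]
  choose l hl0 hl using h.thin s hs s' hs'
  have hflux : ∀ x ε, flux a U (pdy U) s s' (x, ε) = gcst n a * Real.exp (-(nsq x ε) / 4)
      * (incr U s s' (x, ε) * (ε ^ a * (s * unc (pdy U) (dil s (x, ε))))) := fun x ε => by
    rw [flux, gam_eq]; ring
  have hlim : Tendsto (fun ε => - ∫ x, flux a U (pdy U) s s' (x, ε)) (𝓝[>] 0)
      (𝓝 (- ∫ x, gcst n a * Real.exp (-(nsq x 0) / 4) * l x)) := by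
    refine (tendsto_integral_filter_of_dominated_convergence
      (fun x => (gcst n a * (((min s s')⁻¹ * zbound n a R K * |s' - s|) * K))
        * ∏ i, Real.exp (-(1 / 4) * (x i) ^ 2)) ?_ ?_ ?_ ?_).neg
    · filter_upwards [self_mem_nhdsWithin] with ε hε
      refine Continuous.aestronglyMeasurable ?_
      refine (h.contDiffOn_flux (contDiffOn_pdy h.smooth) hs hs').continuousOn.comp_continuous
        (by fun_prop) fun x => hε
    · filter_upwards [self_mem_nhdsWithin] with ε hε
      refine Eventually.of_forall fun x => ?_
      have hq : (x, ε) ∈ upperHalf n := hε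
      have hp : 0 ≤ ∏ i, Real.exp (-(1 / 4) * (x i) ^ 2) :=
        Finset.prod_nonneg fun i _ => (Real.exp_pos _).le
      have he : Real.exp (-(nsq x ε) / 4) ≤ ∏ i, Real.exp (-(1 / 4) * (x i) ^ 2) := by
        rw [exp_nsq]
        exact mul_le_of_le_one_right hp (Real.exp_le_one_iff.2 (by nlinarith [sq_nonneg ε]))
      rw [hflux, Real.norm_eq_abs, abs_mul, abs_mul (incr _ _ _ _),
        abs_of_nonneg (mul_nonneg hg (Real.exp_pos _).le),
        mul_right_comm (gcst n a) ((min s s')⁻¹ * zbound n a R K * |s' - s| * K)]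
      refine mul_le_mul (mul_le_mul_of_nonneg_left he hg) (mul_le_mul
        (h.abs_incr_le hm ⟨min_le_left _ _, hs.2⟩ ⟨min_le_right _ _, hs'.2⟩ hq)
        (h.abs_rpow_mul_smul_pdy_le hs hq) (abs_nonneg _) (by positivity)) (by positivity)
        (by positivity)
    · exact (integrable_gaussian_x n).const_mul _
    · refine Eventually.of_forall fun x => ?_
      simp_rw [hflux]
      refine Tendsto.mul ?_ (hl x)
      have hc : Continuous fun ε : ℝ => gcst n a * Real.exp (-(nsq x ε) / 4) := by
        unfold nsq; fun_prop
      exact (hc.tendsto 0).mono_left nhdsWithin_le_nhds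
  have heq := tendsto_nhds_unique ((tendsto_setIntegral_upperHalf (hi1.add hi2)).congr' (by
    filter_upwards [self_mem_nhdsWithin] with ε hε
    exact h.setIntegral_div_flux hs hs' hε)) hlim
  refine le_of_le_of_eq ?_ heq.symm
  rw [← integral_neg]
  refine integral_nonneg fun x => ?_
  have := mul_nonneg hg (Real.exp_pos (-(nsq x 0) / 4)).le
  simp only [Pi.zero_apply]
  nlinarith [hl0 x]

end Controlled

/-- The energy density `|t| |∇U|²`. -/
def density {n : ℕ} (U : Fn n) (p : Pt n) : ℝ := |p.2.2| * gradSq U p.1 p.2.1 p.2.2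

/-- The Gaussian energy of the rescaling of `U` at scale `s`. -/
def sliceEnergy (n : ℕ) (a : ℝ) (U : Fn n) (s : ℝ) : ℝ :=
  ∫ q in upperHalf n, density U (dil s q) * gam n a q

lemma density_dil {n : ℕ} (U : Fn n) (s : ℝ) (q : (Fin n → ℝ) × ℝ) :
    density U (dil s q)
      = (∑ i, (s * unc (pdx i U) (dil s q)) ^ 2) + (s * unc (pdy U) (dil s q)) ^ 2 := by
  have : |(dil s q).2.2| = s ^ 2 := by simp [dil]
  rw [density, this, gradSq, mul_add, Finset.mul_sum]
  simp only [mul_pow]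
  rfl

namespace Controlled

variable {n : ℕ} {a : ℝ} {F U : Fn n} {R K : ℝ}

lemma continuousOn_density (h : Controlled n a F U R K) :
    ContinuousOn (density U) (openStrip n) := by
  refine ContinuousOn.mul (by fun_prop) (ContinuousOn.add ?_ ?_)
  · exact continuousOn_finsetSum _ fun i _ => (contDiffOn_pdx i h.smooth).continuousOn.pow 2
  · exact (contDiffOn_pdy h.smooth).continuousOn.pow 2

lemma abs_density_le (h : Controlled n a F U R K) {s : ℝ} (hs : s ∈ Set.Ioo (0 : ℝ) 1)
    {q : (Fin n → ℝ) × ℝ} (hq : q ∈ upperHalf n) :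
    |density U (dil s q)| ≤ ((n + 1) * K ^ 2) * (1 + q.2 ^ (-(2 * a))) := by
  have hy : 0 < q.2 := hq
  have h1 : ∑ i, (s * unc (pdx i U) (dil s q)) ^ 2 ≤ n * K ^ 2 := by
    refine (Finset.sum_le_sum fun i _ => (sq_le_sq.2 ((h.abs_smul_pdx_le i hs hq).trans
      (le_abs_self K)) : _ ≤ K ^ 2)).trans ?_
    simp
  have h2 : (s * unc (pdy U) (dil s q)) ^ 2 ≤ (K * q.2 ^ (-a)) ^ 2 :=
    sq_le_sq.2 ((h.abs_smul_pdy_le hs hq).trans (le_abs_self _))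
  have h3 : (q.2 ^ (-a)) ^ 2 = q.2 ^ (-(2 * a)) := by
    rw [← Real.rpow_natCast, ← Real.rpow_mul hy.le]; congr 1; push_cast; ring
  rw [mul_pow K, h3] at h2
  have h4 := Real.rpow_nonneg hy.le (-(2 * a))
  have h5 : 0 ≤ n * K ^ 2 * q.2 ^ (-(2 * a)) := by positivity
  rw [density_dil, abs_of_nonneg (by positivity)]
  nlinarith [sq_nonneg K]

lemma integrableOn_density (h : Controlled n a F U R K) {s : ℝ} (hs : s ∈ Set.Ioo (0 : ℝ) 1) :
    IntegrableOn (fun q => density U (dil s q) * gam n a q) (upperHalf n) :=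
  integrableOn_mul_gam h.neg_one_lt h.lt_one (continuousOn_comp_dil h.continuousOn_density hs)
    fun _ hq => h.abs_density_le hs hq

lemma exists_abs_sliceEnergy_le (h : Controlled n a F U R K) :
    ∃ C, ∀ s ∈ Set.Ioo (0 : ℝ) 1, |sliceEnergy n a U s| ≤ C := by
  refine ⟨∫ q in upperHalf n, (n + 1) * K ^ 2 * dom n a q, fun s hs => ?_⟩
  rw [← Real.norm_eq_abs, sliceEnergy]
  refine norm_integral_le_of_norm_le ((integrableOn_dom h.neg_one_lt h.lt_one).const_mul _)
    (ae_restrict_of_forall_mem (isOpen_upperHalf n).measurableSet fun q hq => ?_)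
  have h0 := gam_nonneg h.neg_one_lt hq
  rw [Real.norm_eq_abs, abs_mul, abs_of_nonneg h0, dom, ← mul_assoc]
  exact mul_le_mul_of_nonneg_right (h.abs_density_le hs hq) h0

lemma two_mul_cross_le (s s' : ℝ) (q : (Fin n → ℝ) × ℝ) :
    2 * cross U s s' q ≤ density U (dil s' q) - density U (dil s q) := by
  rw [density_dil, density_dil, cross, mul_add, Finset.mul_sum, add_sub_add_comm,
    ← Finset.sum_sub_distrib]
  have key : ∀ b c : ℝ, 2 * ((b - c) * c) ≤ b ^ 2 - c ^ 2 := fun b c => by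
    nlinarith [sq_nonneg (b - c)]
  exact add_le_add (Finset.sum_le_sum fun i _ => key _ _) (key _ _)

lemma le_sliceEnergy_sub (h : Controlled n a F U R K) {s s' : ℝ} (hs : s ∈ Set.Ioo (0 : ℝ) 1)
    (hs' : s' ∈ Set.Ioo (0 : ℝ) 1) :
    -2 * (∫ q in upperHalf n, incr U s s' q * drift F U s q * gam n a q)
      ≤ sliceEnergy n a U s' - sliceEnergy n a U s := by
  have h1 := h.variational_inequality hs hs'
  have h2 : 2 * ∫ q in upperHalf n, cross U s s' q * gam n a q
      ≤ sliceEnergy n a U s' - sliceEnergy n a U s := by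
    rw [sliceEnergy, sliceEnergy,
      ← integral_sub (h.integrableOn_density hs') (h.integrableOn_density hs),
      ← integral_const_mul]
    refine setIntegral_mono_on ((h.integrableOn_cross hs hs').const_mul 2)
      ((h.integrableOn_density hs').sub (h.integrableOn_density hs))
      (isOpen_upperHalf n).measurableSet fun q hq => ?_
    rw [← sub_mul, ← mul_assoc]
    exact mul_le_mul_of_nonneg_right (two_mul_cross_le s s' q) (gam_nonneg h.neg_one_lt hq)
  linarith

lemma tendsto_integral_incr_mul_drift (h : Controlled n a F U R K) {s : ℝ}
    (hs : s ∈ Set.Ioo (0 : ℝ) 1) {σ : ℝ → ℝ} (hσ : Tendsto σ (𝓝[≠] s) (𝓝 s)) :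
    Tendsto (fun s' => ∫ q in upperHalf n,
        (s' - s)⁻¹ * incr U s s' q * drift F U (σ s') q * gam n a q) (𝓝[≠] s)
      (𝓝 (∫ q in upperHalf n,
        s⁻¹ * unc (Zop U) (dil s q) * drift F U s q * gam n a q)) := by
  have hm : 0 < s / 2 := half_pos hs.1
  have hz := h.zbound_nonneg
  have hK := h.K_nonneg
  have hmeas := (isOpen_upperHalf n).measurableSet
  have ev1 : ∀ᶠ s' in 𝓝[≠] s, s' ∈ Set.Ioo (s / 2) 1 :=
    nhdsWithin_le_nhds (Ioo_mem_nhds (half_lt_self hs.1) hs.2)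
  have ev2 : ∀ᶠ s' in 𝓝[≠] s, σ s' ∈ Set.Ioo (0 : ℝ) 1 := hσ (Ioo_mem_nhds hs.1 hs.2)
  refine tendsto_integral_filter_of_dominated_convergence
    (fun q => ((s / 2)⁻¹ * zbound n a R K * (zbound n a R K + K)) * dom n a q) ?_ ?_ ?_ ?_
  · filter_upwards [ev1, ev2] with s' h1 h2
    have hs' : s' ∈ Set.Ioo (0 : ℝ) 1 := ⟨hm.trans h1.1, h1.2⟩
    exact (((continuousOn_const.mul (h.contDiffOn_incr hs hs').continuousOn).mul
      (h.continuousOn_drift h2)).mul contDiffOn_gam.continuousOn).aestronglyMeasurable hmeas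
  · filter_upwards [ev1, ev2, self_mem_nhdsWithin] with s' h1 h2 h3
    refine ae_restrict_of_forall_mem hmeas fun q hq => ?_
    have h0 := gam_nonneg h.neg_one_lt hq
    have hne : 0 < |s' - s| := abs_pos.2 (sub_ne_zero.2 h3)
    have hincr := h.abs_incr_le hm ⟨(half_lt_self hs.1).le, hs.2⟩ ⟨h1.1.le, h1.2⟩ hq
    rw [Real.norm_eq_abs, abs_mul, abs_mul, abs_mul, abs_inv, abs_of_nonneg h0]
    refine mul_le_mul (mul_le_mul ?_ (h.abs_drift_le h2 hq) (abs_nonneg _) (by positivity))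
      (gam_le_dom h.neg_one_lt hq) h0 (by positivity)
    rw [inv_mul_le_iff₀ hne]
    linarith
  · exact (integrableOn_dom h.neg_one_lt h.lt_one).const_mul _
  · refine ae_restrict_of_forall_mem hmeas fun q hq => ?_
    have hd := (hasDerivAt_dil_s hs.1.ne'
      (differentiableAt_of_smooth h.smooth (dil_mem hs hq))).tendsto_slope
    exact (hd.mul ((h.tendsto_drift hs hq).tendsto.comp hσ)).mul_const _

lemma hasDerivAt_sliceEnergy (h : Controlled n a F U R K) {s : ℝ} (hs : s ∈ Set.Ioo (0 : ℝ) 1) :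
    HasDerivAt (sliceEnergy n a U)
      (-2 * ∫ q in upperHalf n, s⁻¹ * unc (Zop U) (dil s q) * drift F U s q * gam n a q) s := by
  rw [hasDerivAt_iff_tendsto_slope]
  have t1 := (h.tendsto_integral_incr_mul_drift hs (σ := fun _ => s)
    tendsto_const_nhds).const_mul (-2)
  have t2 := (h.tendsto_integral_incr_mul_drift hs (σ := fun s' => s')
    (tendsto_id.mono_left nhdsWithin_le_nhds)).const_mul (-2)
  have tmin := t1.min t2
  have tmax := t1.max t2
  rw [min_self] at tmin
  rw [max_self] at tmax
  have hconst : ∀ s' σ, ∫ q in upperHalf n,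
      (s' - s)⁻¹ * incr U s s' q * drift F U σ q * gam n a q
      = (s' - s)⁻¹ * ∫ q in upperHalf n, incr U s s' q * drift F U σ q * gam n a q :=
    fun s' σ => by
      rw [← integral_const_mul]
      simp only [mul_assoc]
  have hsymm : ∀ s', ∫ q in upperHalf n, incr U s' s q * drift F U s' q * gam n a q
      = - ∫ q in upperHalf n, incr U s s' q * drift F U s' q * gam n a q := fun s' => by
    rw [← integral_neg]
    congr 1 with q
    simp only [incr]
    ring
  have hbd : ∀ᶠ s' in 𝓝[≠] s,
      slope (sliceEnergy n a U) s s' ∈ Set.uIcc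
        (-2 * ∫ q in upperHalf n, (s' - s)⁻¹ * incr U s s' q * drift F U s q * gam n a q)
        (-2 * ∫ q in upperHalf n, (s' - s)⁻¹ * incr U s s' q * drift F U s' q * gam n a q) := by
    filter_upwards [nhdsWithin_le_nhds (Ioo_mem_nhds hs.1 hs.2), self_mem_nhdsWithin] with s' hs' hne
    have l1 := h.le_sliceEnergy_sub hs hs'
    have l2 := h.le_sliceEnergy_sub hs' hs
    rw [hsymm] at l2
    rw [hconst, hconst, slope_def_field, div_eq_inv_mul, mul_left_comm, mul_left_comm (-2)]
    rcases lt_or_gt_of_ne (show s' ≠ s from hne) with hlt | hgt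
    · have hi : (s' - s)⁻¹ ≤ 0 := inv_nonpos.2 (by linarith)
      exact Set.mem_uIcc.2 (Or.inr ⟨mul_le_mul_of_nonpos_left (by linarith) hi,
        mul_le_mul_of_nonpos_left l1 hi⟩)
    · have hi : 0 ≤ (s' - s)⁻¹ := inv_nonneg.2 (by linarith)
      exact Set.mem_uIcc.2 (Or.inl ⟨mul_le_mul_of_nonneg_left l1 hi,
        mul_le_mul_of_nonneg_left (by linarith) hi⟩)
  exact tendsto_of_tendsto_of_tendsto_of_le_of_le' tmin tmax (hbd.mono fun _ hx => hx.1)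
    (hbd.mono fun _ hx => hx.2)

end Controlled

namespace Controlled

variable {n : ℕ} {a : ℝ} {F U : Fn n} {R K : ℝ}

lemma abs_sq_Zop_le (h : Controlled n a F U R K) {s : ℝ} (hs : s ∈ Set.Ioo (0 : ℝ) 1)
    {q : (Fin n → ℝ) × ℝ} (hq : q ∈ upperHalf n) :
    |unc (Zop U) (dil s q) ^ 2| ≤ zbound n a R K ^ 2 * (1 + q.2 ^ (-(2 * a))) := by
  rw [abs_pow]
  exact (pow_le_pow_left₀ (abs_nonneg _) (h.abs_Zop_le (dil_mem hs hq)) 2).trans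
    (le_mul_of_one_le_right (sq_nonneg _) (one_le_one_add_rpow hq _))

lemma abs_mul_Zop_mul_F_le (h : Controlled n a F U R K) {s : ℝ} (hs : s ∈ Set.Ioo (0 : ℝ) 1)
    {q : (Fin n → ℝ) × ℝ} (hq : q ∈ upperHalf n) :
    |(|(dil s q).2.2| * unc (Zop U) (dil s q) * unc F (dil s q))|
      ≤ zbound n a R K * K * (1 + q.2 ^ (-(2 * a))) := by
  have hz := h.zbound_nonneg
  have hK := h.K_nonneg
  have ht : |(dil s q).2.2| ≤ 1 := by
    have := (dil_mem hs hq).2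
    rw [abs_le]
    constructor <;> linarith [this.1, this.2]
  rw [abs_mul, abs_mul, abs_abs]
  refine (mul_le_mul ((mul_le_of_le_one_left (abs_nonneg _) ht).trans
    (h.abs_Zop_le (dil_mem hs hq))) (h.abs_F_le _ (dil_mem hs hq)) (abs_nonneg _) hz).trans ?_
  exact le_mul_of_one_le_right (mul_nonneg hz hK) (one_le_one_add_rpow hq _)

lemma hasDerivAt_sq_mul_sliceEnergy (h : Controlled n a F U R K) {s : ℝ}
    (hs : s ∈ Set.Ioo (0 : ℝ) 1) :
    HasDerivAt (fun s => s ^ 2 * sliceEnergy n a U s)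
      (2 * s * (∫ q in upperHalf n, density U (dil s q) * gam n a q)
        + ((1 / 2) * (2 * s * ∫ q in upperHalf n, unc (Zop U) (dil s q) ^ 2 * gam n a q)
        + 2 * s * ∫ q in upperHalf n, |(dil s q).2.2| * unc (Zop U) (dil s q) * unc F (dil s q)
          * gam n a q)) s := by
  have hz := h.zbound_nonneg
  have hK := h.K_nonneg
  have hs0 : s ≠ 0 := hs.1.ne'
  have cZ := continuousOn_comp_dil (contDiffOn_Zop h.smooth).continuousOn hs
  have cF := continuousOn_comp_dil h.continuousOn_F hs
  have i1 : IntegrableOn (fun q => unc (Zop U) (dil s q) ^ 2 * gam n a q) (upperHalf n) :=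
    integrableOn_mul_gam h.neg_one_lt h.lt_one (cZ.pow 2) fun q hq =>
      h.abs_sq_Zop_le hs hq
  have i2 : IntegrableOn (fun q => |(dil s q).2.2| * unc (Zop U) (dil s q) * unc F (dil s q)
      * gam n a q) (upperHalf n) :=
    integrableOn_mul_gam h.neg_one_lt h.lt_one
      (((Continuous.continuousOn (by unfold dil; fun_prop)).mul cZ).mul cF) fun q hq =>
      h.abs_mul_Zop_mul_F_le hs hq
  refine ((hasDerivAt_pow 2 s).mul (h.hasDerivAt_sliceEnergy hs)).congr_deriv ?_
  have : ∫ q in upperHalf n, s⁻¹ * unc (Zop U) (dil s q) * drift F U s q * gam n a q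
      = -(1 / 2) * s⁻¹ * (∫ q in upperHalf n, unc (Zop U) (dil s q) ^ 2 * gam n a q)
        - s⁻¹ * ∫ q in upperHalf n, |(dil s q).2.2| * unc (Zop U) (dil s q) * unc F (dil s q)
          * gam n a q := by
    rw [← integral_const_mul, ← integral_const_mul,
      ← integral_sub (i1.const_mul _) (i2.const_mul _)]
    congr 1 with q
    have : |(dil s q).2.2| = s ^ 2 := by simp [dil]
    rw [drift, this]
    ring
  rw [this, ← sliceEnergy]
  field_simp
  push_cast
  ring

lemma continuousOn_sq_mul_sliceEnergy (h : Controlled n a F U R K) {r : ℝ} (hr : r < 1) :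
    ContinuousOn (fun s => s ^ 2 * sliceEnergy n a U s) (Set.Icc 0 r) := by
  intro s hs
  rcases hs.1.eq_or_lt with rfl | h0
  · obtain ⟨C, hC⟩ := h.exists_abs_sliceEnergy_le
    have hlim : Tendsto (fun s : ℝ => s ^ 2 * C) (𝓝[Set.Icc 0 r] 0) (𝓝 0) := by
      have : Continuous fun s : ℝ => s ^ 2 * C := by fun_prop
      simpa using (this.tendsto 0).mono_left nhdsWithin_le_nhds
    rw [ContinuousWithinAt, zero_pow two_ne_zero, zero_mul]
    refine squeeze_zero_norm' ?_ hlim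
    filter_upwards [self_mem_nhdsWithin] with σ hσ
    rcases hσ.1.eq_or_lt with rfl | hσ0
    · simp
    · rw [Real.norm_eq_abs, abs_mul, abs_of_nonneg (sq_nonneg σ)]
      exact mul_le_mul_of_nonneg_left (hC σ ⟨hσ0, hσ.2.trans_lt hr⟩) (sq_nonneg σ)
  · exact (h.hasDerivAt_sq_mul_sliceEnergy
      ⟨h0, hs.2.trans_lt hr⟩).continuousAt.continuousWithinAt

theorem hasDerivAt_Dfn (h : Controlled n a F U R K) {r : ℝ} (hr : r ∈ Set.Ioo (0 : ℝ) 1) :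
    HasDerivAt (Dfn n a U)
      ((1 / r ^ 3) * (∫ p in Splus n r, (Zop U p.1 p.2.1 p.2.2) ^ 2 * wgt n a p)
        + (2 / r ^ 3) *
          ∫ p in Splus n r,
            |p.2.2| * Zop U p.1 p.2.1 p.2.2 * F p.1 p.2.1 p.2.2 * wgt n a p) r := by
  have cZ := (contDiffOn_Zop h.smooth).continuousOn
  have hE : ∀ ρ ∈ Set.Ioo (0 : ℝ) 1, _ := fun ρ hρ =>
    setIntegral_Splus h.neg_one_lt h.lt_one h.continuousOn_density
      (fun s hs q hq => h.abs_density_le hs hq) hρ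
  obtain ⟨iZ, eZ⟩ := setIntegral_Splus (g := fun p => unc (Zop U) p ^ 2) h.neg_one_lt h.lt_one
    (cZ.pow 2) (fun s hs q hq => h.abs_sq_Zop_le hs hq) hr
  obtain ⟨iF, eF⟩ := setIntegral_Splus (g := fun p => |p.2.2| * unc (Zop U) p * unc F p)
    h.neg_one_lt h.lt_one ((ContinuousOn.mul (by fun_prop) cZ).mul h.continuousOn_F)
    (fun s hs q hq => h.abs_mul_Zop_mul_F_le hs hq) hr
  have iE := (hE r hr).1
  have hr0 : r ≠ 0 := hr.1.ne'
  have hparts := intervalIntegral.integral_eq_sub_of_hasDerivAt_of_le hr.1.le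
    (h.continuousOn_sq_mul_sliceEnergy hr.2)
    (fun s hs => h.hasDerivAt_sq_mul_sliceEnergy ⟨hs.1, hs.2.trans hr.2⟩)
    (iE.add ((iZ.const_mul (1 / 2)).add iF))
  rw [intervalIntegral.integral_add iE ((iZ.const_mul (1 / 2)).add iF),
    intervalIntegral.integral_add (iZ.const_mul (1 / 2)) iF, intervalIntegral.integral_const_mul,
    ← eZ, ← eF] at hparts
  have hcont : ContinuousOn
      (fun s => 2 * s * ∫ q in upperHalf n, density U (dil s q) * gam n a q)
      (Set.Ioo (0 : ℝ) 1) := fun s hs =>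
    ((continuousAt_const.mul continuousAt_id).mul
      (h.hasDerivAt_sliceEnergy hs).continuousAt).continuousWithinAt
  have hprim := intervalIntegral.integral_hasDerivAt_right iE
    (hcont.stronglyMeasurableAtFilter isOpen_Ioo r hr)
    (hcont.continuousAt (isOpen_Ioo.mem_nhds hr))
  have hinv : HasDerivAt (fun ρ : ℝ => 1 / ρ ^ 2) (-2 / r ^ 3) r := by
    simp only [one_div]
    refine ((hasDerivAt_pow 2 r).fun_inv (pow_ne_zero 2 hr0)).congr_deriv ?_
    field_simp
    simp [mul_comm]
  refine ((hinv.mul hprim).congr_of_eventuallyEq ?_).congr_deriv ?_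
  · filter_upwards [isOpen_Ioo.mem_nhds hr] with ρ hρ
    rw [Dfn, Pi.mul_apply, ← (hE ρ hρ).2]
    rfl
  · change _ = (1 / r ^ 3) * (∫ p in Splus n r, unc (Zop U) p ^ 2 * wgt n a p)
      + (2 / r ^ 3) * ∫ p in Splus n r, |p.2.2| * unc (Zop U) p * unc F p * wgt n a p
    rw [← sliceEnergy]
    field_simp
    linear_combination -2 * hparts

end Controlled

/-- first variation of the energy. -/
theorem first_variation_energy (n : ℕ) (hn : 1 ≤ n) (a : ℝ) (ha₁ : -1 < a) (ha₂ : a < 1)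
    (F U : Fn n) (hU : SignoriniMem n a F U)
    (hF : ∃ M : ℝ, ∀ x y t, 0 < y → t ∈ Set.Ioc (-1 : ℝ) 0 → |F x y t| ≤ M) :
    ∀ᵐ r ∂(volume.restrict (Set.Ioo (0 : ℝ) 1)),
      HasDerivAt (Dfn n a U)
        ((1 / r ^ 3) * (∫ p in Splus n r, (Zop U p.1 p.2.1 p.2.2) ^ 2 * wgt n a p)
          + (2 / r ^ 3) *
            ∫ p in Splus n r,
              |p.2.2| * Zop U p.1 p.2.1 p.2.2 * F p.1 p.2.1 p.2.2 * wgt n a p) r := by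
  obtain ⟨R, K, h⟩ := hU.controlled ha₁ ha₂ hF
  exact ae_restrict_of_forall_mem measurableSet_Ioo fun r hr => h.hasDerivAt_Dfn hr
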